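/- arXiv:1406.0154 — 6 statements merged into one kernel-verified Lean document; each statement's English description precedes it below -/
import Mathlib

section
/- Let G be a connected bipartite graph with color classes X and Y, having at least one edge and no universal vertices. Then the Hasse graph H(G) of the poset of maximal bicliques of G with both shores nonempty (ordered by X-shore inclusion) is a tree if and only if G is distance hereditary. -/
open SimpleGraph

variable {V : Type*}

/-- `X`, `Y` form a bipartition of the simple graph `G`. -/
def IsBipartition (G : SimpleGraph V) (X Y : Set V) : Prop :=
  Disjoint X Y ∧ X ∪ Y = Set.univ ∧
    ∀ ⦃u v : V⦄, G.Adj u v → (u ∈ X ∧ v ∈ Y) ∨ (u ∈ Y ∧ v ∈ X)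

/-- `G` is distance hereditary. -/
def DistHereditary (G : SimpleGraph V) : Prop :=
  ∀ (S : Set V) (u v : S), (G.induce S).Reachable u v →
    (G.induce S).dist u v = G.dist ↑u ↑v

def IsBiclique (G : SimpleGraph V) (X Y A B : Set V) : Prop :=
  A ⊆ X ∧ B ⊆ Y ∧ ∀ a ∈ A, ∀ b ∈ B, G.Adj a b

def IsMaxBiclique (G : SimpleGraph V) (X Y A B : Set V) : Prop :=
  IsBiclique G X Y A B ∧
    ∀ A' B', IsBiclique G X Y A' B' → A ⊆ A' → B ⊆ B' → A = A' ∧ B = B'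

/-- The maximal bicliques of `G` with both shores nonempty. -/
def MaxBicliques (G : SimpleGraph V) (X Y : Set V) : Set (Set V × Set V) :=
  {p | IsMaxBiclique G X Y p.1 p.2 ∧ p.1.Nonempty ∧ p.2.Nonempty}

/-- `q` covers `p` in the poset of maximal bicliques with nonempty shores,
ordered by inclusion of `X`-shores. -/
def Covers (G : SimpleGraph V) (X Y : Set V) (p q : Set V × Set V) : Prop :=
  p ∈ MaxBicliques G X Y ∧ q ∈ MaxBicliques G X Y ∧ p.1 ⊂ q.1 ∧
    ∀ r ∈ MaxBicliques G X Y, ¬ (p.1 ⊂ r.1 ∧ r.1 ⊂ q.1)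

/-- The Hasse graph of the poset of maximal bicliques with nonempty shores. -/
def HasseGraph (G : SimpleGraph V) (X Y : Set V) :
    SimpleGraph (MaxBicliques G X Y) :=
  SimpleGraph.fromRel (fun p q => Covers G X Y p.val q.val)

def NoUniversalVertex (G : SimpleGraph V) (X Y : Set V) : Prop :=
  (∀ x ∈ X, ∃ y ∈ Y, ¬ G.Adj x y) ∧ (∀ y ∈ Y, ∃ x ∈ X, ¬ G.Adj y x)

def deleteVert (G : SimpleGraph V) (v : V) : SimpleGraph V :=
  SimpleGraph.fromRel (fun a b => G.Adj a b ∧ a ≠ v ∧ b ≠ v)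

def domino : SimpleGraph (Fin 6) :=
  SimpleGraph.fromRel (fun i j => j = i + 1 ∨ (i = 0 ∧ j = 3))

def DominoFree (G : SimpleGraph V) : Prop :=
  ¬ ∃ f : Fin 6 → V, Function.Injective f ∧
      ∀ i j, domino.Adj i j ↔ G.Adj (f i) (f j)

def cycleGraph' (n : ℕ) : SimpleGraph (ZMod n) :=
  SimpleGraph.fromRel (fun i j => j = i + 1)

def HasInducedCycle (G : SimpleGraph V) (n : ℕ) : Prop :=
  ∃ f : ZMod n → V, Function.Injective f ∧
      ∀ i j, (cycleGraph' n).Adj i j ↔ G.Adj (f i) (f j)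

def Chordal (G : SimpleGraph V) : Prop := ∀ n, 4 ≤ n → ¬ HasInducedCycle G n

def Ptolemaic (G : SimpleGraph V) : Prop := Chordal G ∧ DistHereditary G

def MaxCliques (G : SimpleGraph V) : Set (Set V) :=
  {S | G.IsClique S ∧ ∀ T, G.IsClique T → S ⊆ T → S = T}

def cliqueIncidence (G : SimpleGraph V) :
    SimpleGraph (V ⊕ ↥(MaxCliques G)) :=
  SimpleGraph.fromRel (fun a b =>
    match a, b with
    | Sum.inl v, Sum.inr K => v ∈ K.val
    | _, _ => False)

def incidenceY (G : SimpleGraph V) (X Y : Set V) :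
    SimpleGraph (↥Y ⊕ ↥(MaxBicliques G X Y)) :=
  SimpleGraph.fromRel (fun a b =>
    match a, b with
    | Sum.inl y, Sum.inr B => (y : V) ∈ B.val.2
    | _, _ => False)

def incidenceX (G : SimpleGraph V) (X Y : Set V) :
    SimpleGraph (↥X ⊕ ↥(MaxBicliques G X Y)) :=
  SimpleGraph.fromRel (fun a b =>
    match a, b with
    | Sum.inl x, Sum.inr B => (x : V) ∈ B.val.1
    | _, _ => False)

def starGraph (G : SimpleGraph V) (v v' : V) : SimpleGraph (Option V) :=
  SimpleGraph.fromRel (fun a b =>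
    match a, b with
    | some a, some b => G.Adj a b
    | none, some b => G.Adj v b ∧ G.Adj v' b
    | _, _ => False)

/-- The maximal bicliques with nonempty shores, ordered by inclusion of the first shore. -/
def BicliquePoset (G : SimpleGraph V) (X Y : Set V) : Type _ := ↥(MaxBicliques G X Y)

namespace IsBipartition

variable {G : SimpleGraph V} {X Y : Set V}

theorem swap (h : IsBipartition G X Y) : IsBipartition G Y X :=
  ⟨h.1.symm, Set.union_comm X Y ▸ h.2.1, fun _ _ huv => (h.2.2 huv).symm⟩

theorem mem_or_mem (h : IsBipartition G X Y) (v : V) : v ∈ X ∨ v ∈ Y := by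
  have : v ∈ X ∪ Y := h.2.1 ▸ Set.mem_univ v
  exact this

theorem not_mem_right (h : IsBipartition G X Y) {v : V} (hv : v ∈ X) : v ∉ Y :=
  Set.disjoint_left.1 h.1 hv

theorem right_of_adj (h : IsBipartition G X Y) {u v : V} (huv : G.Adj u v) (hu : u ∈ X) :
    v ∈ Y := by
  rcases h.2.2 huv with h' | h'
  · exact h'.2
  · exact absurd h'.1 (h.not_mem_right hu)

theorem left_of_adj (h : IsBipartition G X Y) {u v : V} (huv : G.Adj u v) (hu : u ∈ Y) :
    v ∈ X :=
  h.swap.right_of_adj huv hu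

end IsBipartition

theorem IsMaxBiclique.swap {G : SimpleGraph V} {X Y A B : Set V} (h : IsMaxBiclique G X Y A B) :
    IsMaxBiclique G Y X B A :=
  ⟨⟨h.1.2.1, h.1.1, fun b hb a ha => (h.1.2.2 a ha b hb).symm⟩, fun B' A' h' hB hA =>
    (h.2 A' B' ⟨h'.2.1, h'.1, fun a ha b hb => (h'.2.2 b hb a ha).symm⟩ hA hB).symm⟩

theorem IsMaxBiclique.mem_left {G : SimpleGraph V} {X Y A B : Set V}
    (h : IsMaxBiclique G X Y A B) {x : V} (hx : x ∈ X) (hadj : ∀ b ∈ B, G.Adj x b) : x ∈ A := by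
  have := (h.2 (insert x A) B ⟨Set.insert_subset hx h.1.1, h.1.2.1, ?_⟩
    (Set.subset_insert x A) subset_rfl).1
  · rw [this]
    exact Set.mem_insert x A
  · rintro a (rfl | ha) b hb
    · exact hadj b hb
    · exact h.1.2.2 a ha b hb

namespace BicliquePoset

variable {G : SimpleGraph V} {X Y : Set V}

/-- The shore of a maximal biclique in the first color class. -/
def left (p : BicliquePoset G X Y) : Set V := p.1.1

/-- The shore of a maximal biclique in the second color class. -/
def right (p : BicliquePoset G X Y) : Set V := p.1.2

/-- The same biclique, with the roles of the color classes exchanged. -/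
def swap (p : BicliquePoset G X Y) : BicliquePoset G Y X :=
  ⟨(p.right, p.left), p.2.1.swap, p.2.2.2, p.2.2.1⟩

theorem left_nonempty (p : BicliquePoset G X Y) : p.left.Nonempty := p.2.2.1

theorem right_nonempty (p : BicliquePoset G X Y) : p.right.Nonempty := p.2.2.2

theorem mem_X (p : BicliquePoset G X Y) {x : V} (hx : x ∈ p.left) : x ∈ X := p.2.1.1.1 hx

theorem mem_Y (p : BicliquePoset G X Y) {y : V} (hy : y ∈ p.right) : y ∈ Y := p.2.1.1.2.1 hy

theorem adj (p : BicliquePoset G X Y) {x y : V} (hx : x ∈ p.left) (hy : y ∈ p.right) :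
    G.Adj x y :=
  p.2.1.1.2.2 x hx y hy

theorem mem_left (p : BicliquePoset G X Y) {x : V} (hx : x ∈ X)
    (h : ∀ y ∈ p.right, G.Adj x y) : x ∈ p.left :=
  p.2.1.mem_left hx h

theorem mem_right (p : BicliquePoset G X Y) {y : V} (hy : y ∈ Y)
    (h : ∀ x ∈ p.left, G.Adj x y) : y ∈ p.right :=
  p.2.1.swap.mem_left hy fun x hx => (h x hx).symm

theorem right_subset {p q : BicliquePoset G X Y} (h : p.left ⊆ q.left) : q.right ⊆ p.right :=
  fun _ hy => p.mem_right (q.mem_Y hy) fun _ hx => q.adj (h hx) hy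

theorem left_subset {p q : BicliquePoset G X Y} (h : q.right ⊆ p.right) : p.left ⊆ q.left :=
  right_subset (p := q.swap) (q := p.swap) h

instance : PartialOrder (BicliquePoset G X Y) where
  le p q := p.left ⊆ q.left
  le_refl _ := subset_rfl
  le_trans _ _ _ h h' := h.trans h'
  le_antisymm _ _ h h' :=
    Subtype.ext (Prod.ext (h.antisymm h') ((right_subset h').antisymm (right_subset h)))

theorem le_iff_right {p q : BicliquePoset G X Y} : p ≤ q ↔ q.right ⊆ p.right :=
  ⟨right_subset, left_subset⟩

instance [Finite V] : Finite (BicliquePoset G X Y) :=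
  inferInstanceAs (Finite ↥(MaxBicliques G X Y))

theorem swap_lt_swap {p q : BicliquePoset G X Y} : p.swap < q.swap ↔ q < p := by
  have h (p q : BicliquePoset G X Y) : p.swap ≤ q.swap ↔ q ≤ p := le_iff_right.symm
  simp only [lt_iff_le_not_ge, h]

theorem swap_covBy_swap {p q : BicliquePoset G X Y} (h : p ⋖ q) : q.swap ⋖ p.swap :=
  ⟨swap_lt_swap.2 h.1, fun c hqc hcp =>
    h.2 (c := c.swap) (swap_lt_swap.1 hcp) (swap_lt_swap.1 hqc)⟩

theorem covers_iff {p q : BicliquePoset G X Y} : Covers G X Y p.1 q.1 ↔ p ⋖ q := by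
  have lt (p q : BicliquePoset G X Y) : p < q ↔ p.1.1 ⊂ q.1.1 := Iff.rfl
  constructor
  · exact fun h => ⟨h.2.2.1, fun c hpc hcq => h.2.2.2 c.1 c.2 ⟨hpc, hcq⟩⟩
  · exact fun h => ⟨p.2, q.2, h.1, fun r hr hpr => h.2 (c := ⟨r, hr⟩) hpr.1 hpr.2⟩

theorem hasseGraph_eq : HasseGraph G X Y = hasse (BicliquePoset G X Y) := by
  have key (p q : BicliquePoset G X Y) :
      p ≠ q ∧ (Covers G X Y p.1 q.1 ∨ Covers G X Y q.1 p.1) ↔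
        (hasse (BicliquePoset G X Y)).Adj p q := by
    rw [hasse_adj, covers_iff, covers_iff]
    refine and_iff_right_of_imp ?_
    rintro (h | h)
    exacts [h.ne, h.ne']
  exact SimpleGraph.ext (funext₂ fun p q => propext (key p q))

/-- A nonempty set of vertices of `Y` with a common neighbor generates a maximal biclique. -/
theorem exists_left_iff {T : Set V} (hT : T ⊆ Y) (hne : T.Nonempty) {x : V} (hx : x ∈ X)
    (hadj : ∀ y ∈ T, G.Adj x y) :
    ∃ c : BicliquePoset G X Y, T ⊆ c.right ∧ ∀ x', x' ∈ c.left ↔ x' ∈ X ∧ ∀ y ∈ T, G.Adj x' y := by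
  let A : Set V := {x' | x' ∈ X ∧ ∀ y ∈ T, G.Adj x' y}
  let B : Set V := {y | y ∈ Y ∧ ∀ a ∈ A, G.Adj a y}
  have hTB : T ⊆ B := fun y hy => ⟨hT hy, fun a ha => ha.2 y hy⟩
  refine ⟨⟨(A, B), ⟨⟨fun a ha => ha.1, fun b hb => hb.1, fun a ha b hb => hb.2 a ha⟩, ?_⟩,
    ⟨x, hx, hadj⟩, hne.mono hTB⟩, hTB, fun x' => Iff.rfl⟩
  intro A' B' h hA hB
  have hA' : A' ⊆ A := fun a ha => ⟨h.1 ha, fun y hy => h.2.2 a ha y (hB (hTB hy))⟩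
  exact ⟨hA.antisymm hA', hB.antisymm fun b hb => ⟨h.2.1 hb, fun a ha => h.2.2 a (hA ha) b hb⟩⟩

theorem exists_principal (hbip : IsBipartition G X Y) {v w : V} (hvw : G.Adj v w) :
    ∃ c : BicliquePoset G X Y,
      (v ∈ X → v ∈ c.left ∧ ∀ z : BicliquePoset G X Y, v ∈ z.left → c ≤ z) ∧
      (v ∈ Y → v ∈ c.right ∧ ∀ z : BicliquePoset G X Y, v ∈ z.right → z ≤ c) := by
  rcases hbip.mem_or_mem v with hv | hv
  · obtain ⟨c, hc, hc'⟩ := exists_left_iff (G := G) (T := {y | y ∈ Y ∧ G.Adj v y})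
      (fun y hy => hy.1) ⟨w, hbip.right_of_adj hvw hv, hvw⟩ hv (fun y hy => hy.2)
    exact ⟨c, fun _ => ⟨(hc' v).2 ⟨hv, fun y hy => hy.2⟩, fun z hz => le_iff_right.2
      fun y hy => hc ⟨z.mem_Y hy, z.adj hz hy⟩⟩, fun h => absurd h (hbip.not_mem_right hv)⟩
  · obtain ⟨c, hc, hc'⟩ := exists_left_iff (G := G) (T := {v})
      (Set.singleton_subset_iff.2 hv) ⟨v, rfl⟩ (hbip.left_of_adj hvw hv)
      (fun y hy => by rw [Set.mem_singleton_iff.1 hy]; exact hvw.symm)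
    exact ⟨c, fun h => absurd hv (hbip.not_mem_right h), fun _ => ⟨hc rfl, fun z hz x hx =>
      (hc' x).2 ⟨z.mem_X hx, fun y hy => by
        rw [Set.mem_singleton_iff.1 hy]; exact z.adj hx hz⟩⟩⟩

end BicliquePoset

section Hasse

variable {α : Type*} [PartialOrder α] [Finite α]

/-- A saturated chain from `a` to `b` avoids the cover `p ⋖ q` unless `a ≤ p` and `q ≤ b`. -/
theorem hasse_deleteEdges_reachable {p q : α} (hpq : p < q) {a b : α} (hab : a ≤ b)
    (h : ¬ (a ≤ p ∧ q ≤ b)) : ((hasse α).deleteEdges {s(p, q)}).Reachable a b := by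
  induction a using WellFoundedGT.induction with
  | ind a ih =>
    rcases hab.eq_or_lt with rfl | hlt
    · exact Reachable.refl _
    · obtain ⟨c, hac, hcb⟩ := exists_covBy_le_of_lt hlt
      refine Reachable.trans (Adj.reachable ?_)
        (ih c hac.lt hcb fun hc => h ⟨hac.le.trans hc.1, hc.2⟩)
      rw [deleteEdges_adj, hasse_adj]
      refine ⟨Or.inl hac, fun he => ?_⟩
      rcases Sym2.eq_iff.1 he with ⟨rfl, rfl⟩ | ⟨rfl, rfl⟩
      · exact h ⟨le_rfl, hcb⟩
      · exact lt_asymm hpq hac.lt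

theorem hasse_reachable_of_le {a b : α} (hab : a ≤ b) : (hasse α).Reachable a b := by
  induction a using WellFoundedGT.induction with
  | ind a ih =>
    rcases hab.eq_or_lt with rfl | hlt
    · exact Reachable.refl _
    · obtain ⟨c, hac, hcb⟩ := exists_covBy_le_of_lt hlt
      exact Reachable.trans (Adj.reachable (Or.inl hac)) (ih c hac.lt hcb)

end Hasse

section Walks

variable {W : Type*} {H : SimpleGraph W}

/-- If the component of `a` after deleting an edge contains no end of a second edge, then it stays
connected when the second edge is deleted instead. -/
theorem reachable_deleteEdges_of_not_reachable {e : Set (Sym2 W)} {p q a b : W}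
    (hp : ¬ (H.deleteEdges e).Reachable a p)
    (hab : (H.deleteEdges e).Reachable a b) : (H.deleteEdges {s(p, q)}).Reachable a b := by
  rw [reachable_iff_reflTransGen] at hab
  induction hab with
  | refl => exact Reachable.refl _
  | @tail b c hb hbc ih =>
    rw [← reachable_iff_reflTransGen] at hb
    refine ih.trans (Adj.reachable ?_)
    rw [deleteEdges_adj]
    refine ⟨(deleteEdges_adj.1 hbc).1, fun he => ?_⟩
    rcases Sym2.eq_iff.1 he with ⟨rfl, rfl⟩ | ⟨rfl, rfl⟩
    · exact hp hb
    · exact hp (hb.trans hbc.reachable)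

theorem exists_nonbacktracking_of_not_isAcyclic (h : ¬ H.IsAcyclic) :
    ∃ z : ℕ → W, ∀ n, H.Adj (z n) (z (n + 1)) ∧ z n ≠ z (n + 2) := by
  simp only [IsAcyclic, not_forall, not_not] at h
  obtain ⟨v, c, hc⟩ := h
  have h3 := hc.three_le_length
  have hlt (n : ℕ) : n % c.length < c.length := Nat.mod_lt _ (by lia)
  have hmod (n m : ℕ) (hm : m < c.length) : (n + m) % c.length =
      if n % c.length + m < c.length then n % c.length + m
      else n % c.length + m - c.length := by
    rw [Nat.add_mod, Nat.mod_eq_of_lt hm]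
    split_ifs with h
    · exact Nat.mod_eq_of_lt h
    · rw [Nat.mod_eq_sub_mod (by lia), Nat.mod_eq_of_lt (by have := hlt n; lia)]
  refine ⟨fun n => c.getVert (n % c.length), fun n => ⟨?_, fun he => ?_⟩⟩
  · have hadj := c.adj_getVert_succ (hlt n)
    have := hmod n 1 (by lia)
    split_ifs at this with h
    · simpa only [this] using hadj
    · have h1 : n % c.length + 1 = c.length := by have := hlt n; lia
      have h0 : (n + 1) % c.length = 0 := by lia
      rw [h1, Walk.getVert_length] at hadj
      simpa only [h0, Walk.getVert_zero] using hadj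
  · have h1 := hlt n
    have h2 := hlt (n + 2)
    have := hc.getVert_injOn' (by rw [Set.mem_ofPred_eq]; lia) (by rw [Set.mem_ofPred_eq]; lia) he
    have := hmod n 2 (by lia)
    split_ifs at this <;> lia

end Walks
section DistanceHereditary

variable {G : SimpleGraph V} {X Y : Set V}

theorem DistHereditary.dist_eq_of_induced (hG : DistHereditary G) {u : ℕ → V} {n : ℕ}
    (hadj : ∀ a b, a < b → b ≤ n → (G.Adj (u a) (u b) ↔ b = a + 1))
    (hne : ∀ a b, a < b → b ≤ n → u a ≠ u b) : G.dist (u 0) (u n) = n := by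
  let S : Set V := u '' Set.Iic n
  have hmem (i : ℕ) (hi : i ≤ n) : u i ∈ S := Set.mem_image_of_mem u hi
  have hinj (a b : ℕ) (ha : a ≤ n) (hb : b ≤ n) (h : u a = u b) : a = b := by
    rcases lt_trichotomy a b with h' | h' | h'
    exacts [absurd h (hne a b h' hb), h', absurd h.symm (hne b a h' ha)]
  have hwalk (m : ℕ) (hm : m ≤ n) : ∃ w : (G.induce S).Walk ⟨u 0, hmem 0 (Nat.zero_le n)⟩
      ⟨u m, hmem m hm⟩, w.length = m := by
    induction m with
    | zero => exact ⟨Walk.nil, rfl⟩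
    | succ m ih =>
      obtain ⟨w, hw⟩ := ih (by lia)
      have h : (G.induce S).Adj ⟨u m, hmem m (by lia)⟩ ⟨u (m + 1), hmem (m + 1) hm⟩ :=
        (hadj m (m + 1) (by lia) hm).2 rfl
      exact ⟨w.concat h, by rw [Walk.length_concat, hw]⟩
  choose φ hφ hφu using fun s : S => s.2
  have hstep (s t : S) (h : (G.induce S).Adj s t) : φ t ≤ φ s + 1 := by
    have h' : G.Adj (u (φ s)) (u (φ t)) := by rw [hφu, hφu]; exact h
    rcases lt_or_ge (φ s) (φ t) with hlt | hge
    · exact ((hadj _ _ hlt (hφ t)).1 h').le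
    · lia
  have hlen (s t : S) (w : (G.induce S).Walk s t) : φ t ≤ φ s + w.length := by
    induction w with
    | nil => simp
    | cons h w ih =>
      have := hstep _ _ h
      rw [Walk.length_cons]
      lia
  have hidx (i : ℕ) (hi : i ≤ n) : φ ⟨u i, hmem i hi⟩ = i := hinj _ _ (hφ _) hi (hφu _)
  obtain ⟨w, hw⟩ := hwalk n le_rfl
  rw [← hG S ⟨u 0, hmem 0 (Nat.zero_le n)⟩ ⟨u n, hmem n le_rfl⟩ w.reachable]
  refine le_antisymm ((dist_le w).trans_eq hw) ?_
  obtain ⟨w', hw'⟩ := w.reachable.exists_walk_length_eq_dist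
  have := hlen _ _ w'
  rw [hidx n le_rfl, hidx 0 (Nat.zero_le n)] at this
  lia

/-- The walk `v 0, …, v k` is such that any four consecutive vertices induce a path. -/
structure IsLocallyInduced (G : SimpleGraph V) (v : ℕ → V) (k : ℕ) : Prop where
  adj : ∀ i, i < k → G.Adj (v i) (v (i + 1))
  ne : ∀ i, i + 2 ≤ k → v i ≠ v (i + 2)
  not_adj : ∀ i, i + 3 ≤ k → ¬ G.Adj (v i) (v (i + 3))

theorem IsLocallyInduced.exists_extend {v : ℕ → V} {k : ℕ} (h : IsLocallyInduced G v k) {y : V}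
    (hadj : G.Adj (v k) y) (hne : ∀ i, i + 1 = k → v i ≠ y)
    (hnot : ∀ i, i + 2 = k → ¬ G.Adj (v i) y) :
    ∃ v' : ℕ → V, IsLocallyInduced G v' (k + 1) ∧ (∀ i, i ≤ k → v' i = v i) ∧ v' (k + 1) = y := by
  have hold (i : ℕ) (hi : i ≤ k) : Function.update v (k + 1) y i = v i :=
    Function.update_of_ne (by lia) _ _
  have hnew (i : ℕ) (hi : i = k + 1) : Function.update v (k + 1) y i = y := by
    rw [hi, Function.update_self]
  refine ⟨Function.update v (k + 1) y, ⟨fun i hi => ?_, fun i hi => ?_, fun i hi => ?_⟩,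
    hold, hnew _ rfl⟩
  · rw [hold i (by lia)]
    rcases Nat.lt_succ_iff_lt_or_eq.1 hi with h' | rfl
    · rw [hold _ (by lia)]
      exact h.adj i h'
    · rwa [hnew _ rfl]
  · rw [hold i (by lia)]
    rcases Nat.le_succ_iff.1 hi with h' | h'
    · rw [hold _ h']
      exact h.ne i h'
    · rw [hnew _ h']
      exact hne i (by lia)
  · rw [hold i (by lia)]
    rcases Nat.le_succ_iff.1 hi with h' | h'
    · rw [hold _ h']
      exact h.not_adj i h'
    · rw [hnew _ h']
      exact hnot i (by lia)

theorem IsBipartition.not_adj_of_common_adj (hbip : IsBipartition G X Y) {a b c : V}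
    (hab : G.Adj a b) (hbc : G.Adj b c) : ¬ G.Adj a c := fun hac => by
  rcases hbip.mem_or_mem a with h | h
  · exact hbip.not_mem_right (hbip.left_of_adj hbc (hbip.right_of_adj hab h))
      (hbip.right_of_adj hac h)
  · exact hbip.not_mem_right (hbip.left_of_adj hac h)
      (hbip.right_of_adj hbc (hbip.left_of_adj hab h))

theorem IsLocallyInduced.dist_eq {v : ℕ → V} {k : ℕ} (h : IsLocallyInduced G v k)
    (hG : DistHereditary G) (hbip : IsBipartition G X Y) (hconn : G.Connected) {i n : ℕ}
    (hin : i + n ≤ k) : G.dist (v i) (v (i + n)) = n := by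
  induction n using Nat.strong_induction_on generalizing i with
  | _ n ih =>
    have hsub (a b : ℕ) (hab : a < b) (hb : b ≤ n) (hlt : b - a < n) :
        G.dist (v (i + a)) (v (i + b)) = b - a := by
      have := ih (b - a) hlt (i := i + a) (by lia)
      rwa [show i + a + (b - a) = i + b by lia] at this
    have hends : 2 ≤ n → v i ≠ v (i + n) ∧ ¬ G.Adj (v i) (v (i + n)) := by
      intro hn
      obtain rfl | rfl | hn4 : n = 2 ∨ n = 3 ∨ 4 ≤ n := by lia
      · exact ⟨h.ne i hin, hbip.not_adj_of_common_adj (h.adj i (by lia)) (h.adj (i + 1) (by lia))⟩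
      · refine ⟨fun he => ?_, h.not_adj i hin⟩
        exact hbip.not_adj_of_common_adj (h.adj i (by lia)) (h.adj (i + 1) (by lia))
          (he ▸ (h.adj (i + 2) (by lia)).symm)
      · have h1 := hsub 0 (n - 1) (by lia) (by lia) (by lia)
        have h2 := hsub (n - 1) n (by lia) le_rfl (by lia)
        have h3 := hconn.dist_triangle (u := v i) (v := v (i + n)) (w := v (i + (n - 1)))
        rw [dist_comm (u := v (i + n))] at h3
        rw [add_zero] at h1
        constructor
        · intro he
          rw [← he, dist_self] at h3
          rw [he] at h1
          rw [dist_comm] at h1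
          lia
        · intro hadj
          rw [dist_eq_one_iff_adj.2 hadj] at h3
          lia
    refine hG.dist_eq_of_induced (u := fun j => v (i + j)) (fun a b hab hb => ?_)
      fun a b hab hb => ?_
    · rcases lt_or_ge (b - a) n with hlt | hge
      · rw [← dist_eq_one_iff_adj, hsub a b hab hb hlt]
        lia
      · obtain ⟨rfl, rfl⟩ : a = 0 ∧ b = n := by lia
        constructor
        · intro hadj
          by_contra hn
          exact (hends (by lia)).2 hadj
        · rintro rfl
          exact h.adj i (by lia)
    · rcases lt_or_ge (b - a) n with hlt | hge
      · intro he
        have := hsub a b hab hb hlt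
        rw [he, dist_self] at this
        lia
      · obtain ⟨rfl, rfl⟩ : a = 0 ∧ b = n := by lia
        rcases Nat.lt_or_ge b 2 with hn | hn
        · obtain rfl : b = 1 := by lia
          exact (h.adj i (by lia)).ne
        · exact (hends hn).1

end DistanceHereditary

namespace BicliquePoset

variable {G : SimpleGraph V} {X Y : Set V}

theorem le_or_le_of_common (hG : DistHereditary G) (hbip : IsBipartition G X Y)
    (hconn : G.Connected) {p q : BicliquePoset G X Y} {x y : V} (hxp : x ∈ p.left)
    (hxq : x ∈ q.left) (hyp : y ∈ p.right) (hyq : y ∈ q.right) : p ≤ q ∨ q ≤ p := by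
  by_contra! hpq
  obtain ⟨a, hap, haq⟩ := Set.not_subset.1 hpq.1
  obtain ⟨b, hbq, hbp⟩ := Set.not_subset.1 hpq.2
  obtain ⟨d, hd, had⟩ : ∃ d ∈ q.right, ¬ G.Adj a d := by
    by_contra! h
    exact haq (q.mem_left (p.mem_X hap) h)
  obtain ⟨c, hc, hbc⟩ : ∃ c ∈ p.right, ¬ G.Adj b c := by
    by_contra! h
    exact hbp (p.mem_left (q.mem_X hbq) h)
  have h0 : IsLocallyInduced G (fun _ => a) 0 :=
    ⟨fun i hi => by lia, fun i hi => by lia, fun i hi => by lia⟩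
  obtain ⟨v₁, h1, e1, l1⟩ := h0.exists_extend (p.adj hap hc) (fun i hi => by lia)
    (fun i hi => by lia)
  have e10 : v₁ 0 = a := e1 0 le_rfl
  obtain ⟨v₂, h2, e2, l2⟩ := h1.exists_extend (y := x) (l1 ▸ (p.adj hxp hc).symm)
    (fun i hi => by
      obtain rfl : i = 0 := by lia
      rw [e10]
      rintro rfl
      exact haq hxq) (fun i hi => by lia)
  have e20 : v₂ 0 = a := (e2 0 (by lia)).trans e10
  have e21 : v₂ 1 = c := (e2 1 (by lia)).trans l1
  obtain ⟨v₃, h3, e3, l3⟩ := h2.exists_extend (y := d) (l2 ▸ q.adj hxq hd)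
    (fun i hi => by
      obtain rfl : i = 1 := by lia
      rw [e21]
      rintro rfl
      exact hbc (q.adj hbq hd))
    (fun i hi => by
      obtain rfl : i = 0 := by lia
      rwa [e20])
  have e30 : v₃ 0 = a := (e3 0 (by lia)).trans e20
  have e31 : v₃ 1 = c := (e3 1 (by lia)).trans e21
  have e32 : v₃ 2 = x := (e3 2 (by lia)).trans l2
  obtain ⟨v₄, h4, e4, l4⟩ := h3.exists_extend (y := b) (l3 ▸ (q.adj hbq hd).symm)
    (fun i hi => by
      obtain rfl : i = 2 := by lia
      rw [e32]
      rintro rfl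
      exact hbp hxp)
    (fun i hi => by
      obtain rfl : i = 1 := by lia
      rw [e31]
      exact fun h => hbc h.symm)
  have e40 : v₄ 0 = a := (e4 0 (by lia)).trans e30
  have h := h4.dist_eq hG hbip hconn (i := 0) (n := 4) le_rfl
  have l4' : v₄ (0 + 4) = b := l4
  rw [e40, l4'] at h
  have := dist_le (Walk.cons (p.adj hap hyp) (Walk.cons (q.adj hbq hyq).symm Walk.nil))
  simp only [Walk.length_cons, Walk.length_nil] at this
  lia

/-- A locally induced walk `v 0, …, v k` of `G` follows the turns of the walk `z` in the Hasse
graph before step `n`, which goes upwards. -/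
structure FollowsTurns (z : ℕ → BicliquePoset G X Y) (n k : ℕ) (v : ℕ → V) : Prop where
  isLocallyInduced : IsLocallyInduced G v k
  covBy : z n ⋖ z (n + 1)
  mem : v k ∈ (z n).left
  notMem : ∀ i, i + 1 = k → v i ∉ (z (n + 1)).right
  not_adj : ∀ i, i + 2 = k → ∀ y ∈ (z (n + 1)).right, ¬ G.Adj (v i) y

theorem FollowsTurns.exists_turn (hG : DistHereditary G) (hbip : IsBipartition G X Y)
    (hconn : G.Connected) {z : ℕ → BicliquePoset G X Y} {n k : ℕ} {v : ℕ → V}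
    (h : FollowsTurns z n k v) (hdown : z (n + 2) ⋖ z (n + 1)) (hne : z n ≠ z (n + 2)) :
    ∃ v', FollowsTurns (fun i => (z i).swap) (n + 1) (k + 1) v' := by
  obtain ⟨y, hy⟩ := (z (n + 1)).right_nonempty
  have hsep (x : V) (hx : x ∈ (z n).left) : x ∉ (z (n + 2)).left := by
    intro hx'
    rcases le_or_le_of_common hG hbip hconn hx hx' (right_subset h.covBy.le hy)
      (right_subset hdown.le hy) with hle | hle
    · exact h.covBy.2 (hle.lt_of_ne hne) hdown.1
    · exact hdown.2 (hle.lt_of_ne hne.symm) h.covBy.1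
  have hk : v k ∈ (z (n + 1)).left := h.covBy.le h.mem
  obtain ⟨v', hv', hold, hnew⟩ := h.isLocallyInduced.exists_extend ((z (n + 1)).adj hk hy)
    (fun i hi he => h.notMem i hi (he ▸ hy)) (fun i hi => h.not_adj i hi y hy)
  refine ⟨v', hv', swap_covBy_swap hdown, ?_, fun i hi => ?_, fun i hi x hx => ?_⟩
  · rw [hnew]
    exact hy
  · obtain rfl : i = k := by lia
    rw [hold i le_rfl]
    exact hsep _ h.mem
  · replace hx : x ∈ (z (n + 2)).left := hx
    rw [hold i (by lia)]
    intro hadj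
    have hik : G.Adj (v i) (v k) := by
      obtain rfl : k = i + 1 := by lia
      exact h.isLocallyInduced.adj i (by lia)
    have hiY : v i ∈ Y := hbip.right_of_adj hik.symm ((z n).mem_X h.mem)
    obtain ⟨t, hTt, ht⟩ := exists_left_iff (G := G) (X := X) (Y := Y)
      (T := insert (v i) (z (n + 1)).right) (x := v k)
      (Set.insert_subset hiY fun b hb => (z (n + 1)).mem_Y hb) (Set.insert_nonempty _ _)
      ((z n).mem_X h.mem) (by
        rintro b (rfl | hb)
        exacts [hik.symm, (z (n + 1)).adj hk hb])
    have hkt : v k ∈ t.left := (ht _).2 ⟨(z n).mem_X h.mem, by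
      rintro b (rfl | hb)
      exacts [hik.symm, (z (n + 1)).adj hk hb]⟩
    have hxt : x ∈ t.left := (ht _).2 ⟨(z (n + 2)).mem_X hx, by
      rintro b (rfl | hb)
      exacts [hadj.symm, (z (n + 1)).adj (hdown.le hx) hb]⟩
    have htlt : t < z (n + 1) := by
      refine lt_of_le_of_ne (le_iff_right.2 fun b hb => hTt (Set.mem_insert_of_mem _ hb)) ?_
      intro he
      exact h.notMem i (by lia) (he ▸ hTt (Set.mem_insert _ _))
    have htn : t ≤ z n := by
      rcases le_or_le_of_common hG hbip hconn hkt h.mem (hTt (Set.mem_insert_of_mem _ hy))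
        (right_subset h.covBy.le hy) with hle | hle
      · exact hle
      · rcases hle.eq_or_lt with he | hlt
        · exact he.ge
        · exact absurd htlt (h.covBy.2 hlt)
    exact hsep x (htn hxt) hx

theorem FollowsTurns.exists_next [Finite V] (hG : DistHereditary G) (hbip : IsBipartition G X Y)
    (hconn : G.Connected) {z : ℕ → BicliquePoset G X Y}
    (hz : ∀ n, (z n ⋖ z (n + 1) ∨ z (n + 1) ⋖ z n) ∧ z n ≠ z (n + 2)) {n k : ℕ} {v : ℕ → V}
    (h : FollowsTurns z n k v) : ∃ m v', FollowsTurns (fun i => (z i).swap) m (k + 1) v' := by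
  generalize hp : z (n + 1) = p
  induction p using WellFoundedGT.induction generalizing n with
  | ind p ih =>
    subst hp
    rcases (hz (n + 1)).1 with hup | hdown
    · exact ih _ hup.lt ⟨h.isLocallyInduced, hup, h.covBy.le h.mem,
        fun i hi hmem => h.notMem i hi (right_subset hup.le hmem),
        fun i hi y hy => h.not_adj i hi y (right_subset hup.le hy)⟩ rfl
    · exact ⟨n + 1, h.exists_turn hG hbip hconn hdown (hz n).2⟩

theorem exists_followsTurns [Finite V] (hG : DistHereditary G) (hbip : IsBipartition G X Y)
    (hconn : G.Connected) {z : ℕ → BicliquePoset G X Y}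
    (hz : ∀ n, (z n ⋖ z (n + 1) ∨ z (n + 1) ⋖ z n) ∧ z n ≠ z (n + 2)) (k : ℕ) :
    ∃ n v, FollowsTurns z n k v ∨ FollowsTurns (fun i => (z i).swap) n k v := by
  have hswap_ne (p q : BicliquePoset G X Y) (h : p ≠ q) : p.swap ≠ q.swap :=
    fun he => h (congrArg swap he)
  have hz' (n : ℕ) : ((z n).swap ⋖ (z (n + 1)).swap ∨ (z (n + 1)).swap ⋖ (z n).swap) ∧
      (z n).swap ≠ (z (n + 2)).swap :=
    ⟨(hz n).1.symm.imp swap_covBy_swap swap_covBy_swap, hswap_ne _ _ (hz n).2⟩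
  induction k with
  | zero =>
    have h0 (v : V) : IsLocallyInduced G (fun _ => v) 0 :=
      ⟨fun i hi => by lia, fun i hi => by lia, fun i hi => by lia⟩
    rcases (hz 0).1 with h | h
    · obtain ⟨x, hx⟩ := (z 0).left_nonempty
      exact ⟨0, fun _ => x, Or.inl ⟨h0 x, h, hx, fun i hi => by lia, fun i hi => by lia⟩⟩
    · obtain ⟨y, hy⟩ := (z 0).right_nonempty
      exact ⟨0, fun _ => y, Or.inr ⟨h0 y, swap_covBy_swap h, hy, fun i hi => by lia,
        fun i hi => by lia⟩⟩
  | succ k ih =>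
    obtain ⟨n, v, h | h⟩ := ih
    · obtain ⟨m, v', h'⟩ := h.exists_next hG hbip hconn hz
      exact ⟨m, v', Or.inr h'⟩
    · obtain ⟨m, v', h'⟩ := h.exists_next hG hbip.swap hconn hz'
      exact ⟨m, v', Or.inl h'⟩

theorem isAcyclic_hasse [Finite V] (hG : DistHereditary G) (hbip : IsBipartition G X Y)
    (hconn : G.Connected) : (hasse (BicliquePoset G X Y)).IsAcyclic := by
  by_contra hcyc
  obtain ⟨z, hz⟩ := exists_nonbacktracking_of_not_isAcyclic hcyc
  obtain ⟨v, hv⟩ : ∃ v, IsLocallyInduced G v (Nat.card V) := by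
    obtain ⟨n, v, h | h⟩ := exists_followsTurns hG hbip hconn hz (Nat.card V)
    exacts [⟨v, h.isLocallyInduced⟩, ⟨v, h.isLocallyInduced⟩]
  have hinj : Function.Injective fun i : Fin (Nat.card V + 1) => v i := by
    intro a b hab
    wlog hle : a ≤ b generalizing a b
    · exact (this hab.symm (le_of_not_ge hle)).symm
    have h := hv.dist_eq hG hbip hconn (i := a) (n := b - a) (by lia)
    rw [show (a : ℕ) + (b - a) = b by lia, show v a = v b from hab, dist_self] at h
    lia
  have := Nat.card_le_card_of_injective _ hinj
  rw [Nat.card_fin] at this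
  lia

end BicliquePoset
namespace BicliquePoset

variable {G : SimpleGraph V} {X Y : Set V}

/-- `f` maps each vertex to the extremal biclique containing it: the least one for vertices
of `X` and the greatest one for vertices of `Y`. -/
def IsPrincipalMap (f : V → BicliquePoset G X Y) : Prop :=
  ∀ v, (v ∈ X → v ∈ (f v).left ∧ ∀ z : BicliquePoset G X Y, v ∈ z.left → f v ≤ z) ∧
    (v ∈ Y → v ∈ (f v).right ∧ ∀ z : BicliquePoset G X Y, v ∈ z.right → z ≤ f v)

theorem exists_isPrincipalMap (hbip : IsBipartition G X Y) (hconn : G.Connected)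
    (hedge : ∃ u v, G.Adj u v) : ∃ f : V → BicliquePoset G X Y, IsPrincipalMap f := by
  obtain ⟨a, b, hab⟩ := hedge
  have : Nontrivial V := ⟨a, b, hab.ne⟩
  have h (v : V) := exists_principal hbip (hconn.preconnected.exists_adj_of_nontrivial v).choose_spec
  exact ⟨fun v => (h v).choose, fun v => (h v).choose_spec⟩

/-- The vertices that can be ends of edges of `G` crossing the cover `p ⋖ q`. -/
def crossing (p q : BicliquePoset G X Y) : Set V := p.left ∪ q.right

/-- `u` and `v` lie on the same side of the edge `pq` of the Hasse graph. -/
def SameSide (f : V → BicliquePoset G X Y) (p q : BicliquePoset G X Y) (u v : V) : Prop :=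
  ((hasse (BicliquePoset G X Y)).deleteEdges {s(p, q)}).Reachable (f u) (f v)

theorem mem_left_of_mem_crossing (hbip : IsBipartition G X Y) {p q : BicliquePoset G X Y} {u : V}
    (hu : u ∈ crossing p q) (hX : u ∈ X) : u ∈ p.left :=
  hu.resolve_right fun h => hbip.not_mem_right hX (q.mem_Y h)

theorem mem_right_of_mem_crossing (hbip : IsBipartition G X Y) {p q : BicliquePoset G X Y} {u : V}
    (hu : u ∈ crossing p q) (hY : u ∈ Y) : u ∈ q.right :=
  hu.resolve_left fun h => hbip.not_mem_right (p.mem_X h) hY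

namespace IsPrincipalMap

variable {f : V → BicliquePoset G X Y}

theorem le_of_adj (hf : IsPrincipalMap f) {u v : V} (huv : G.Adj u v) (hu : u ∈ X) (hv : v ∈ Y) :
    f u ≤ f v := by
  obtain ⟨c, hc, hc'⟩ := exists_left_iff (G := G) (T := {v})
    (Set.singleton_subset_iff.2 hv) ⟨v, rfl⟩ hu
    (fun y hy => by rw [Set.mem_singleton_iff.1 hy]; exact huv)
  refine (((hf u).1 hu).2 c ((hc' u).2 ⟨hu, fun y hy => ?_⟩)).trans (((hf v).2 hv).2 c (hc rfl))
  rw [Set.mem_singleton_iff.1 hy]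
  exact huv

variable [Finite V]

theorem hasse_preconnected (hf : IsPrincipalMap f) (hbip : IsBipartition G X Y)
    (hconn : G.Connected) : (hasse (BicliquePoset G X Y)).Preconnected := by
  have hadj (u v : V) (h : G.Adj u v) : (hasse (BicliquePoset G X Y)).Reachable (f u) (f v) := by
    rcases hbip.2.2 h with ⟨hu, hv⟩ | ⟨hu, hv⟩
    · exact hasse_reachable_of_le (hf.le_of_adj h hu hv)
    · exact (hasse_reachable_of_le (hf.le_of_adj h.symm hv hu)).symm
  have hreach (u v : V) (h : G.Reachable u v) :
      (hasse (BicliquePoset G X Y)).Reachable (f u) (f v) := by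
    obtain ⟨w⟩ := h
    induction w with
    | nil => exact Reachable.refl _
    | cons h _ ih => exact (hadj _ _ h).trans ih
  intro p q
  obtain ⟨x, hx⟩ := p.left_nonempty
  obtain ⟨x', hx'⟩ := q.left_nonempty
  exact (hasse_reachable_of_le (((hf x).1 (p.mem_X hx)).2 p hx)).symm.trans
    ((hreach x x' (hconn x x')).trans (hasse_reachable_of_le (((hf x').1 (q.mem_X hx')).2 q hx')))

variable {p q : BicliquePoset G X Y}

theorem reachable_of_mem_left (hf : IsPrincipalMap f) (hpq : p < q) {x : V} (hx : x ∈ p.left) :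
    ((hasse (BicliquePoset G X Y)).deleteEdges {s(p, q)}).Reachable (f x) p :=
  hasse_deleteEdges_reachable hpq (((hf x).1 (p.mem_X hx)).2 p hx) fun h => h.2.not_gt hpq

theorem reachable_of_mem_right (hf : IsPrincipalMap f) (hpq : p < q) {y : V} (hy : y ∈ q.right) :
    ((hasse (BicliquePoset G X Y)).deleteEdges {s(p, q)}).Reachable q (f y) :=
  hasse_deleteEdges_reachable hpq (((hf y).2 (q.mem_Y hy)).2 q hy) fun h => h.1.not_gt hpq

theorem sameSide_of_adj (hf : IsPrincipalMap f) (hbip : IsBipartition G X Y) (hpq : p < q)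
    {u v : V} (huv : G.Adj u v) (h : ¬ (u ∈ crossing p q ∧ v ∈ crossing p q)) :
    SameSide f p q u v := by
  wlog hu : u ∈ X generalizing u v
  · exact (this huv.symm (fun h' => h h'.symm)
      (hbip.left_of_adj huv ((hbip.mem_or_mem u).resolve_left hu))).symm
  have hv := hbip.right_of_adj huv hu
  refine hasse_deleteEdges_reachable hpq (hf.le_of_adj huv hu hv) fun hle => h ⟨?_, ?_⟩
  · exact Or.inl (hle.1 ((hf u).1 hu).1)
  · exact Or.inr (right_subset hle.2 ((hf v).2 hv).1)

theorem sameSide_of_mem_left (hf : IsPrincipalMap f) (hbip : IsBipartition G X Y) (hpq : p < q)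
    {u v : V} (hu : u ∈ crossing p q) (hv : v ∈ crossing p q) (huX : u ∈ X) (hvX : v ∈ X) :
    SameSide f p q u v :=
  (hf.reachable_of_mem_left hpq (mem_left_of_mem_crossing hbip hu huX)).trans
    (hf.reachable_of_mem_left hpq (mem_left_of_mem_crossing hbip hv hvX)).symm

theorem sameSide_of_mem_right (hf : IsPrincipalMap f) (hbip : IsBipartition G X Y) (hpq : p < q)
    {u v : V} (hu : u ∈ crossing p q) (hv : v ∈ crossing p q) (huY : u ∈ Y) (hvY : v ∈ Y) :
    SameSide f p q u v :=
  (hf.reachable_of_mem_right hpq (mem_right_of_mem_crossing hbip hu huY)).symm.trans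
    (hf.reachable_of_mem_right hpq (mem_right_of_mem_crossing hbip hv hvY))

/-- Two crossing vertices in the same color class are on the same side. -/
theorem sameSide_of_mem_iff (hf : IsPrincipalMap f) (hbip : IsBipartition G X Y) (hpq : p < q)
    {u v : V} (hu : u ∈ crossing p q) (hv : v ∈ crossing p q) (huv : u ∈ X ↔ v ∈ X) :
    SameSide f p q u v := by
  rcases hbip.mem_or_mem u with h | h
  · exact hf.sameSide_of_mem_left hbip hpq hu hv h (huv.1 h)
  · refine hf.sameSide_of_mem_right hbip hpq hu hv h ((hbip.mem_or_mem v).resolve_left fun h' => ?_)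
    exact hbip.not_mem_right (huv.2 h') h

theorem not_sameSide (hf : IsPrincipalMap f) (hbip : IsBipartition G X Y)
    (hac : (hasse (BicliquePoset G X Y)).IsAcyclic) (hpq : p ⋖ q) {u v : V} (huv : G.Adj u v)
    (hu : u ∈ crossing p q) (hv : v ∈ crossing p q) : ¬ SameSide f p q u v := by
  wlog huX : u ∈ X generalizing u v
  · exact fun h => this huv.symm hv hu
      (hbip.left_of_adj huv ((hbip.mem_or_mem u).resolve_left huX)) h.symm
  intro h
  refine isBridge_iff.1 (isAcyclic_iff_forall_adj_isBridge.1 hac (Or.inl hpq : (hasse _).Adj p q)) ?_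
  exact (hf.reachable_of_mem_left hpq.lt (mem_left_of_mem_crossing hbip hu huX)).symm.trans
    (h.trans (hf.reachable_of_mem_right hpq.lt
      (mem_right_of_mem_crossing hbip hv (hbip.right_of_adj huv huX))).symm)

/-- If the edges of the Hasse graph crossed by two consecutive edges of `G` ending and starting
at `b`, respectively, are `pq` and `p'q'`, then the side of `pq` not containing `b` is contained
in a side of `p'q'`. -/
theorem sameSide_of_sameSide (hf : IsPrincipalMap f) (hbip : IsBipartition G X Y) (hpq : p < q)
    {p' q' : BicliquePoset G X Y} (hpq' : p' < q') {b c : V} (hbc : G.Adj b c)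
    (hc : c ∉ crossing p q) (hb' : b ∈ crossing p' q') (hc' : c ∈ crossing p' q') {u v : V}
    (hub : ¬ SameSide f p q u b) (huv : SameSide f p q u v) : SameSide f p' q' u v := by
  refine reachable_deleteEdges_of_not_reachable (fun h => hub (h.trans ?_)) huv
  rcases hbip.mem_or_mem b with hbX | hbY
  · have hcY := hbip.right_of_adj hbc hbX
    have hbp' := mem_left_of_mem_crossing hbip hb' hbX
    refine (hasse_deleteEdges_reachable hpq (((hf b).1 hbX).2 p' hbp') fun hle => hc ?_).symm
    exact Or.inr (right_subset (hle.2.trans hpq'.le) (mem_right_of_mem_crossing hbip hc' hcY))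
  · have hcX := hbip.left_of_adj hbc hbY
    have hbq' := mem_right_of_mem_crossing hbip hb' hbY
    refine hasse_deleteEdges_reachable hpq (hpq'.le.trans (((hf b).2 hbY).2 q' hbq'))
      fun hle => hc ?_
    exact Or.inl (hle.1 (mem_left_of_mem_crossing hbip hc' hcX))

theorem exists_covBy_crossing (hf : IsPrincipalMap f) (hbip : IsBipartition G X Y) {a b c d : V}
    (hab : G.Adj a b) (hbc : G.Adj b c) (hcd : G.Adj c d) (had : ¬ G.Adj a d) :
    ∃ p q : BicliquePoset G X Y, p ⋖ q ∧ a ∉ crossing p q ∧ b ∈ crossing p q ∧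
      c ∈ crossing p q ∧ d ∉ crossing p q := by
  wlog hb : b ∈ X generalizing a b c d
  · obtain ⟨p, q, hpq, hd, hc, hb, ha⟩ := this hcd.symm hbc.symm hab.symm (fun h => had h.symm)
      (hbip.left_of_adj hbc ((hbip.mem_or_mem b).resolve_left hb))
    exact ⟨p, q, hpq, ha, hb, hc, hd⟩
  have haY := hbip.right_of_adj hab.symm hb
  have hcY := hbip.right_of_adj hbc hb
  have hdX := hbip.left_of_adj hcd hcY
  obtain ⟨p, hTp, hp⟩ := exists_left_iff (G := G) (X := X) (Y := Y) (T := {a, c}) (x := b)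
    (Set.insert_subset haY (Set.singleton_subset_iff.2 hcY)) (Set.insert_nonempty _ _) hb (by
      rintro y (rfl | rfl)
      exacts [hab.symm, hbc])
  have hdp : d ∉ p.left := fun h => had (((hp d).1 h).2 a (Set.mem_insert _ _)).symm
  have hpc : p ≤ f c := ((hf c).2 hcY).2 p (hTp (Set.mem_insert_of_mem _ rfl))
  have hdc : d ∈ (f c).left :=
    hf.le_of_adj hcd.symm hdX hcY ((hf d).1 hdX).1
  obtain ⟨q, hpq, hqc⟩ := exists_covBy_le_of_lt (hpc.lt_of_ne fun h => hdp (h ▸ hdc))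
  have hcq : c ∈ q.right := right_subset hqc ((hf c).2 hcY).1
  refine ⟨p, q, hpq, ?_, Or.inl ((hp b).2 ⟨hb, ?_⟩), Or.inr hcq, ?_⟩
  · intro h
    have haq := mem_right_of_mem_crossing hbip h haY
    refine hpq.lt.not_ge fun x hx => (hp x).2 ⟨q.mem_X hx, ?_⟩
    rintro y (rfl | rfl)
    exacts [q.adj hx haq, q.adj hx hcq]
  · rintro y (rfl | rfl)
    exacts [hab.symm, hbc]
  · exact fun h => hdp (mem_left_of_mem_crossing hbip h hdX)

/-- In a tree, an induced walk of length at least three is not longer than any other walk between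
its ends. -/
theorem length_le_of_induced (hf : IsPrincipalMap f) (hbip : IsBipartition G X Y)
    (hac : (hasse (BicliquePoset G X Y)).IsAcyclic) {v : ℕ → V} {k : ℕ}
    (hv : ∀ i, i < k → G.Adj (v i) (v (i + 1)))
    (hind : ∀ i j, i + 2 ≤ j → j ≤ k → ¬ G.Adj (v i) (v j)) (hk : 3 ≤ k) {w : ℕ → V} {l : ℕ}
    (hw : ∀ i, i < l → G.Adj (w i) (w (i + 1))) (h0 : w 0 = v 0) (hl : w l = v k)
    (hlpos : 0 < l) : k ≤ l := by
  have hex (j : ℕ) : ∃ p q : BicliquePoset G X Y, j + 3 ≤ k → p ⋖ q ∧ v j ∉ crossing p q ∧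
      v (j + 1) ∈ crossing p q ∧ v (j + 2) ∈ crossing p q ∧ v (j + 3) ∉ crossing p q := by
    by_cases hj : j + 3 ≤ k
    · obtain ⟨p, q, h⟩ := hf.exists_covBy_crossing hbip (hv j (by lia)) (hv (j + 1) (by lia))
        (hv (j + 2) (by lia)) (hind j (j + 3) (by lia) hj)
      exact ⟨p, q, fun _ => h⟩
    · exact ⟨f (v 0), f (v 0), fun h => absurd h hj⟩
  choose p q hpq using hex
  have hadj (j : ℕ) (hj : j + 3 ≤ k) {a b c : V} (ha : a ∈ crossing (p j) (q j))
      (hb : b ∈ crossing (p j) (q j)) (hc : c ∈ crossing (p j) (q j)) (hab : G.Adj a b) :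
      G.Adj a c ∨ G.Adj b c := by
    wlog haX : a ∈ X generalizing a b
    · exact (this hb ha hab.symm
        (hbip.left_of_adj hab ((hbip.mem_or_mem a).resolve_left haX))).symm
    have hbY := hbip.right_of_adj hab haX
    rcases hbip.mem_or_mem c with h | h
    · right
      exact ((q j).adj ((hpq j hj).1.le (mem_left_of_mem_crossing hbip hc h))
        (mem_right_of_mem_crossing hbip hb hbY)).symm
    · left
      exact (q j).adj ((hpq j hj).1.le (mem_left_of_mem_crossing hbip ha haX))
        (mem_right_of_mem_crossing hbip hc h)
  have hbefore (j i : ℕ) (hj : j + 3 ≤ k) (hi : i ≤ j + 1) :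
      SameSide f (p j) (q j) (v 0) (v i) := by
    induction i with
    | zero => exact Reachable.refl _
    | succ i ih =>
      refine (ih (by lia)).trans (hf.sameSide_of_adj hbip (hpq j hj).1.lt (hv i (by lia)) ?_)
      rintro ⟨h1, h2⟩
      rcases Nat.lt_or_ge i j with hij | hij
      · rcases hadj j hj h1 h2 (hpq j hj).2.2.2.1 (hv i (by lia)) with h | h
        · exact hind i (j + 2) (by lia) (by lia) h
        · exact hind (i + 1) (j + 2) (by lia) (by lia) h
      · obtain rfl : i = j := by lia
        exact (hpq i hj).2.1 h1
  have hafter (j i : ℕ) (hj : j + 3 ≤ k) (hi : j + 2 ≤ i) (hik : i ≤ k) :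
      SameSide f (p j) (q j) (v (j + 2)) (v i) := by
    induction i, hi using Nat.le_induction with
    | base => exact Reachable.refl _
    | succ i hi ih =>
      refine (ih (by lia)).trans (hf.sameSide_of_adj hbip (hpq j hj).1.lt (hv i (by lia)) ?_)
      rintro ⟨h1, h2⟩
      rcases hi.eq_or_lt with rfl | hij
      · exact (hpq j hj).2.2.2.2 h2
      · rcases hadj j hj h1 h2 (hpq j hj).2.2.1 (hv i (by lia)) with h | h
        · exact hind (j + 1) i (by lia) (by lia) h.symm
        · exact hind (j + 1) (i + 1) (by lia) (by lia) h.symm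
  have hacross (j : ℕ) (hj : j + 3 ≤ k) : ¬ SameSide f (p j) (q j) (v 0) (v (j + 2)) := fun h =>
    hf.not_sameSide hbip hac (hpq j hj).1 (hv (j + 1) (by lia)) (hpq j hj).2.2.1
      (hpq j hj).2.2.2.1 ((hbefore j (j + 1) hj le_rfl).symm.trans h)
  have hmain (t j : ℕ) (ht : t ≤ l) (hj : j + 3 ≤ k) (htj : t ≤ j + 1) :
      SameSide f (p j) (q j) (v 0) (w t) := by
    induction t generalizing j with
    | zero => rw [h0]; exact Reachable.refl _
    | succ t ih =>
      by_contra hns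
      have hwt := hw t ht
      have hcross (j : ℕ) (hj : j + 3 ≤ k) (htj : t ≤ j + 1)
          (hns : ¬ SameSide f (p j) (q j) (v 0) (w (t + 1))) :
          w t ∈ crossing (p j) (q j) ∧ w (t + 1) ∈ crossing (p j) (q j) := by
        by_contra h
        exact hns ((ih j (by lia) hj htj).trans
          (hf.sameSide_of_adj hbip (hpq j hj).1.lt hwt h))
      have hc := hcross j hj (by lia) hns
      rcases Nat.eq_zero_or_pos j with rfl | hjpos
      · obtain rfl : t = 0 := by lia
        exact (hpq 0 hj).2.1 (h0 ▸ hc.1)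
      · obtain ⟨j, rfl⟩ : ∃ i, j = i + 1 := ⟨j - 1, by lia⟩
        have hj' : j + 3 ≤ k := by lia
        have hns' : ¬ SameSide f (p j) (q j) (v 0) (w (t + 1)) := fun h =>
          hns (hf.sameSide_of_sameSide hbip (hpq j hj').1.lt (hpq (j + 1) hj).1.lt
            (hv (j + 2) (by lia)) (hpq j hj').2.2.2.2 (hpq (j + 1) hj).2.2.1
            (hpq (j + 1) hj).2.2.2.1 (hacross j hj') h)
        have hc' := hcross j hj' (by lia) hns'
        by_cases hside : w t ∈ X ↔ v (j + 2) ∈ X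
        · exact hacross j hj' ((ih j (by lia) hj' (by lia)).trans
            (hf.sameSide_of_mem_iff hbip (hpq j hj').1.lt hc'.1 (hpq j hj').2.2.2.1 hside))
        · have hside' : v (j + 2) ∈ X ↔ w (t + 1) ∈ X := by
            have h1 : w t ∈ X ↔ w (t + 1) ∉ X := by
              rcases hbip.mem_or_mem (w t) with h | h
              · exact iff_of_true h (hbip.swap.not_mem_right (hbip.right_of_adj hwt h))
              · exact iff_of_false (hbip.swap.not_mem_right h)
                  (not_not.2 (hbip.left_of_adj hwt h))
            tauto
          exact hns ((hbefore (j + 1) (j + 2) hj (by lia)).trans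
            (hf.sameSide_of_mem_iff hbip (hpq (j + 1) hj).1.lt (hpq (j + 1) hj).2.2.1 hc.2
              hside'))
  by_contra! hlk
  obtain ⟨j, rfl⟩ : ∃ j, k = j + 3 := ⟨k - 3, by lia⟩
  obtain ⟨t, rfl⟩ : ∃ t, l = t + 1 := ⟨l - 1, by lia⟩
  have hs := hmain t j (by lia) le_rfl (by lia)
  refine hacross j le_rfl (hs.trans (Reachable.trans ?_ (hafter j (j + 3) le_rfl (by lia)
    le_rfl).symm))
  rw [← hl]
  refine hf.sameSide_of_adj hbip (hpq j le_rfl).1.lt (hw t (by lia)) fun h => ?_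
  rw [hl] at h
  exact (hpq j le_rfl).2.2.2.2 h.2

theorem distHereditary (hf : IsPrincipalMap f) (hbip : IsBipartition G X Y)
    (hconn : G.Connected) (hac : (hasse (BicliquePoset G X Y)).IsAcyclic) :
    DistHereditary G := by
  intro S a b hab
  obtain ⟨P, hP⟩ := hab.exists_walk_length_eq_dist
  obtain ⟨Q, hQ⟩ := (hconn (a : V) (b : V)).exists_walk_length_eq_dist
  rw [← hP, ← hQ]
  refine le_antisymm ?_ ?_
  · by_contra! hlt
    have hlpos : 0 < Q.length := by
      by_contra! h0
      have : (a : V) = b := Q.eq_of_length_eq_zero (by lia)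
      obtain rfl := Subtype.ext this
      rw [dist_self] at hP
      lia
    have hk : 3 ≤ P.length := by
      by_contra! hk
      have h1 : Q.length = 1 := by lia
      have hadj : (G.induce S).Adj a b := Q.adj_of_length_eq_one h1
      rw [dist_eq_one_iff_adj.2 hadj] at hP
      lia
    refine hlt.not_ge (hf.length_le_of_induced hbip hac (v := fun i => (P.getVert i : V))
      (fun i hi => P.adj_getVert_succ hi) (fun i j hij hj hadj => ?_) hk (w := Q.getVert)
      (fun i hi => Q.adj_getVert_succ hi) (by simp) (by simp) hlpos)
    have hadj' : (G.induce S).Adj (P.getVert i) (P.getVert j) := hadj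
    have := dist_le ((P.take i).append (Walk.cons hadj' (P.drop j)))
    simp only [Walk.length_append, Walk.length_cons, Walk.take_length, Walk.drop_length] at this
    lia
  · rw [hQ]
    exact (dist_le (P.map (Embedding.induce S).toHom)).trans_eq (Walk.length_map _ P)

end IsPrincipalMap

end BicliquePoset

/-- For a connected bipartite graph with at least one edge and no
universal vertices, the Hasse graph of the poset of maximal bicliques with
nonempty shores is a tree iff `G` is distance hereditary. -/
theorem hasse_tree_iff_distance_hereditary [Fintype V] (G : SimpleGraph V)
    (X Y : Set V) (hbip : IsBipartition G X Y) (hconn : G.Connected)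
    (hedge : ∃ u v, G.Adj u v) (huniv : NoUniversalVertex G X Y) :
    (HasseGraph G X Y).IsTree ↔ DistHereditary G := by
  obtain ⟨f, hf⟩ := BicliquePoset.exists_isPrincipalMap hbip hconn hedge
  have hH : (HasseGraph G X Y).IsTree ↔ (hasse (BicliquePoset G X Y)).IsTree :=
    iff_of_eq (congrArg IsTree BicliquePoset.hasseGraph_eq)
  obtain ⟨u, -⟩ := hedge
  have : Nonempty (BicliquePoset G X Y) := ⟨f u⟩
  rw [hH]
  exact ⟨fun h => hf.distHereditary hbip hconn h.2, fun h =>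
    ⟨⟨hf.hasse_preconnected hbip hconn⟩, BicliquePoset.isAcyclic_hasse h hbip hconn⟩⟩
end

section
/- Let G be a bipartite distance hereditary graph with color classes X and Y, and let v, v' ∈ X. Let G ⋆ {v,v'} be the bipartite graph obtained from G by adding one new vertex w to the color class X, where w is adjacent exactly to the vertices of N(v) ∩ N(v'). Then G ⋆ {v,v'} is bipartite distance hereditary. -/
open SimpleGraph

variable {V : Type*}

/-- `p 0, …, p k` is an induced path of `G`. -/
def IsInducedPath (G : SimpleGraph V) (k : ℕ) (p : ℕ → V) : Prop :=
  ∀ i j, i < j → j ≤ k → p i ≠ p j ∧ (G.Adj (p i) (p j) ↔ j = i + 1)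

namespace IsInducedPath

variable {G : SimpleGraph V} {k : ℕ} {p : ℕ → V}

theorem shift (h : IsInducedPath G k p) {i l : ℕ} (hl : i + l ≤ k) :
    IsInducedPath G l (fun n => p (i + n)) := by
  intro a b hab hb
  have := h (i + a) (i + b) (by omega) (by omega)
  refine ⟨this.1, this.2.trans ?_⟩
  omega

theorem reverse (h : IsInducedPath G k p) : IsInducedPath G k (fun n => p (k - n)) := by
  intro a b hab hb
  have := h (k - b) (k - a) (by omega) (by omega)
  refine ⟨this.1.symm, (G.adj_comm _ _).trans (this.2.trans ?_)⟩
  omega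

theorem injOn (h : IsInducedPath G k p) {i j : ℕ} (hi : i ≤ k) (hj : j ≤ k)
    (hij : p i = p j) : i = j := by
  rcases lt_trichotomy i j with hlt | rfl | hlt
  · exact absurd hij (h i j hlt hj).1
  · rfl
  · exact absurd hij.symm (h j i hlt hi).1

theorem adj_iff (h : IsInducedPath G k p) {i j : ℕ} (hi : i ≤ k) (hj : j ≤ k) :
    G.Adj (p i) (p j) ↔ j = i + 1 ∨ i = j + 1 := by
  rcases lt_trichotomy i j with hlt | rfl | hlt
  · rw [(h i j hlt hj).2]; omega
  · simp
  · rw [G.adj_comm, (h j i hlt hi).2]; omega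

theorem exists_walk (h : IsInducedPath G k p) :
    ∃ W : G.Walk (p 0) (p k), W.length = k := by
  induction k with
  | zero => exact ⟨.nil, rfl⟩
  | succ k ih =>
    obtain ⟨W, hW⟩ := ih (fun i j hij hj => h i j hij (by omega))
    exact ⟨W.concat ((h k (k + 1) (by omega) le_rfl).2.2 rfl), by simp [hW]⟩

theorem dist_le (h : IsInducedPath G k p) : G.dist (p 0) (p k) ≤ k := by
  obtain ⟨W, hW⟩ := h.exists_walk
  exact (SimpleGraph.dist_le W).trans hW.le

theorem le_length_of_walk (h : IsInducedPath G k p) {S : Set V}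
    (hS : ∀ x ∈ S, ∃ i ≤ k, p i = x) {x y : S} (W : (G.induce S).Walk x y) :
    ∀ i j, i ≤ k → j ≤ k → p i = x → p j = y → j ≤ i + W.length := by
  induction W with
  | nil =>
    intro i j hi hj hx hy
    simp [h.injOn hi hj (hx.trans hy.symm)]
  | @cons x z y hadj W ih =>
    intro i j hi hj hx hy
    obtain ⟨l, hl, hz⟩ := hS z z.2
    have h1 := ih l j hl hj hz hy
    have h2 : G.Adj (p i) (p l) := by rw [hx, hz]; exact hadj
    rw [h.adj_iff hi hl] at h2
    rw [Walk.length_cons]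
    omega

theorem dist_eq (hG : DistHereditary G) (h : IsInducedPath G k p) :
    G.dist (p 0) (p k) = k := by
  set S : Set V := {x | ∃ i ≤ k, p i = x}
  have mem (i : ℕ) (hi : i ≤ k) : p i ∈ S := ⟨i, hi, rfl⟩
  have reach (i : ℕ) (hi : i ≤ k) :
      (G.induce S).Reachable ⟨p 0, mem 0 (Nat.zero_le k)⟩ ⟨p i, mem i hi⟩ := by
    induction i with
    | zero => exact Reachable.refl _
    | succ i ih =>
      refine (ih (by omega)).trans (Adj.reachable ?_)
      exact (h i (i + 1) (by omega) hi).2.2 rfl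
  have hd : _ = G.dist (p 0) (p k) := hG S _ _ (reach k le_rfl)
  obtain ⟨W, hW⟩ := (reach k le_rfl).exists_walk_length_eq_dist
  have := h.le_length_of_walk (fun x hx => hx) W 0 k (Nat.zero_le k) le_rfl rfl rfl
  have := h.dist_le
  omega

theorem dist_eq_of_le_two (h : IsInducedPath G k p) (hk : k ≤ 2) :
    G.dist (p 0) (p k) = k := by
  obtain ⟨W, hW⟩ := h.exists_walk
  have hle := h.dist_le
  obtain rfl | hpos := Nat.eq_zero_or_pos k
  · simp
  have hne := (h 0 k hpos le_rfl).1
  have hd := W.reachable.pos_dist_of_ne hne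
  obtain rfl | rfl : k = 1 ∨ k = 2 := by omega
  · omega
  · have : G.dist (p 0) (p 2) ≠ 1 := by
      rw [Ne, dist_eq_one_iff_adj, (h 0 2 hpos le_rfl).2]
      omega
    omega

end IsInducedPath

theorem isInducedPath_getVert {G : SimpleGraph V} {S : Set V} {x y : S}
    (W : (G.induce S).Walk x y) (hW : W.length = (G.induce S).dist x y) :
    IsInducedPath G W.length (fun n => (W.getVert n : V)) := by
  intro i j hij hj
  have h1 : (G.induce S).dist x y ≤
      i + ((G.induce S).dist (W.getVert i) (W.getVert j) + (W.length - j)) := by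
    obtain ⟨W₁, hW₁⟩ := Reachable.exists_walk_length_eq_dist
      ((W.take i).reachable.symm.trans (W.take j).reachable)
    have := SimpleGraph.dist_le ((W.take i).append (W₁.append (W.drop j)))
    simp only [Walk.length_append, Walk.take_length, Walk.drop_length] at this
    omega
  constructor
  · intro heq
    have : W.getVert i = W.getVert j := Subtype.ext heq
    rw [this, dist_self] at h1
    omega
  · constructor
    · intro hadj
      have : (G.induce S).Adj (W.getVert i) (W.getVert j) := hadj
      rw [dist_eq_one_iff_adj.2 this] at h1
      omega
    · rintro rfl
      exact W.adj_getVert_succ (by omega)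

theorem distHereditary_of_isInducedPath_dist {G : SimpleGraph V}
    (h : ∀ k p, IsInducedPath G k p → G.dist (p 0) (p k) = k) : DistHereditary G := by
  intro S x y hxy
  obtain ⟨W, hW⟩ := hxy.exists_walk_length_eq_dist
  have := h _ _ (isInducedPath_getVert W hW)
  simp only [Walk.getVert_zero, Walk.getVert_length] at this
  omega

theorem IsBipartition.not_adj_of_adj_of_adj {G : SimpleGraph V} {X Y : Set V}
    (h : IsBipartition G X Y) {a b c : V} (hab : G.Adj a b) (hbc : G.Adj b c) :
    ¬ G.Adj a c := by
  intro hac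
  have hd : ∀ x, x ∈ X → x ∈ Y → False := fun x hx hy => Set.disjoint_left.1 h.1 hx hy
  have h1 := h.2.2 hab
  have h2 := h.2.2 hbc
  have h3 := h.2.2 hac
  have ha := hd a
  have hb := hd b
  have hc := hd c
  tauto

section StarGraph

variable {G : SimpleGraph V} {v v' : V}

@[simp] theorem starGraph_adj_some_some {a b : V} :
    (starGraph G v v').Adj (some a) (some b) ↔ G.Adj a b := by
  simp only [_root_.starGraph, fromRel_adj, ne_eq, Option.some.injEq]
  exact ⟨fun h => h.2.elim id fun h => h.symm, fun h => ⟨h.ne, .inl h⟩⟩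

@[simp] theorem starGraph_adj_none_some {b : V} :
    (starGraph G v v').Adj none (some b) ↔ G.Adj v b ∧ G.Adj v' b := by
  simp [_root_.starGraph]

@[simp] theorem starGraph_adj_some_none {b : V} :
    (starGraph G v v').Adj (some b) none ↔ G.Adj v b ∧ G.Adj v' b := by
  rw [SimpleGraph.adj_comm, starGraph_adj_none_some]

theorem starGraph_comm (G : SimpleGraph V) (v v' : V) :
    starGraph G v v' = starGraph G v' v := by
  ext a b
  cases a <;> cases b <;> simp [and_comm]

/-- The homomorphism from `starGraph G v v'` to `G` sending the new vertex to `v`. -/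
def starGraphProj (G : SimpleGraph V) (v v' : V) : starGraph G v v' →g G where
  toFun a := a.getD v
  map_rel' {a b} h := by
    cases a <;> cases b <;> simp_all [SimpleGraph.adj_comm]

theorem IsInducedPath.proj {k : ℕ} {p : ℕ → Option V}
    (h : IsInducedPath (starGraph G v v') k p)
    (hgood : ∀ i ≤ k, ∀ j ≤ k, ∀ a, p i = none → p j = some a →
      a ≠ v ∧ (G.Adj v a → j = i + 1 ∨ i = j + 1)) :
    IsInducedPath G k (fun n => (p n).getD v) := by
  intro i j hij hj
  obtain ⟨hne, hadj⟩ := h i j hij hj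
  have g1 := hgood i (by omega) j hj
  have g2 := hgood j hj i (by omega)
  have hhom := (starGraphProj G v v').map_rel (a := p i) (b := p j)
  change _ → G.Adj ((p i).getD v) ((p j).getD v) at hhom
  refine ⟨?_, fun hG => ?_, fun e => hhom (hadj.2 e)⟩
  · intro heq
    cases hi : p i <;> cases hj : p j <;> simp_all
  · cases hpi : p i with
    | none =>
      cases hpj : p j with
      | none => simp [hpi, hpj] at hG
      | some b =>
        have := (g1 b hpi hpj).2 (by simpa [hpi, hpj] using hG)
        omega
    | some a =>
      cases hpj : p j with
      | none =>
        have := (g2 a hpj hpi).2 (by simpa [hpi, hpj] using hG.symm)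
        omega
      | some b => exact hadj.1 (by simpa [hpi, hpj] using hG)

theorem IsInducedPath.dist_starGraph_eq (hG : DistHereditary G) {k : ℕ} {p : ℕ → Option V}
    (h : IsInducedPath (starGraph G v v') k p)
    (h' : IsInducedPath G k (fun n => (p n).getD v)) :
    (starGraph G v v').dist (p 0) (p k) = k := by
  have h1 := h'.dist_eq hG
  obtain ⟨W', -⟩ := h.exists_walk
  obtain ⟨W, hW⟩ := W'.reachable.exists_walk_length_eq_dist
  have h2 := SimpleGraph.dist_le (W.map (starGraphProj G v v'))
  rw [Walk.length_map] at h2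
  change G.dist ((p 0).getD v) ((p k).getD v) ≤ _ at h2
  have := h.dist_le
  omega

theorem IsInducedPath.eq_some {k : ℕ} {p : ℕ → Option V} {H : SimpleGraph (Option V)}
    (h : IsInducedPath H k p) {i j : ℕ} (hi : i ≤ k) (hj : j ≤ k) (hij : i ≠ j)
    (hp : p i = none) : ∃ a, p j = some a := by
  cases hpj : p j with
  | none => exact absurd (h.injOn hi hj (hp.trans hpj.symm)) hij
  | some a => exact ⟨a, rfl⟩

/-- A vertex after the new vertex `p i` where replacing `p i` by `v` breaks inducedness lies at
distance two or three along the path. -/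
theorem IsInducedPath.eq_add_two_or_three (hG : DistHereditary G)
    (htri : ∀ {a b c : V}, G.Adj a b → G.Adj b c → ¬ G.Adj a c) {k : ℕ} {p : ℕ → Option V}
    (h : IsInducedPath (starGraph G v v') k p) {i j : ℕ} {a : V} (hij : i < j) (hj : j ≤ k)
    (hi : p i = none) (ha : p j = some a)
    (hbad : ¬ (a ≠ v ∧ (G.Adj v a → j = i + 1))) :
    j = i + 2 ∧ a = v ∨ j = i + 3 ∧ G.Adj v a := by
  obtain ⟨y, hy⟩ := h.eq_some (i := i) (j := i + 1) (by omega) (by omega) (by omega) hi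
  have hvy : G.Adj v y ∧ G.Adj v' y := by
    have := (h i (i + 1) (by omega) (by omega)).2.2 rfl
    rwa [hi, hy, starGraph_adj_none_some] at this
  have hya := h.adj_iff (i := i + 1) (j := j) (by omega) (by omega)
  rw [hy, ha, starGraph_adj_some_some] at hya
  by_cases hav : a = v
  · subst hav
    have := hya.1 hvy.1.symm
    have : j = i + 2 := by omega
    exact .inl ⟨this, rfl⟩
  obtain ⟨hva, hj1⟩ : G.Adj v a ∧ j ≠ i + 1 := by
    simpa [hav] using hbad
  have hj2 : j ≠ i + 2 := fun e => htri hvy.1 (hya.2 (by omega)) hva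
  have hQ := (h.shift (i := i + 1) (l := j - (i + 1)) (by omega)).proj (by
    intro n hn _ _ _ hnone
    have := h.injOn (i := i) (by omega) (by omega) (hi.trans hnone.symm)
    omega)
  have hd := hQ.dist_eq hG
  have hd2 := SimpleGraph.dist_le (Walk.cons hvy.1.symm (Walk.cons hva Walk.nil))
  rw [show i + 1 + (j - (i + 1)) = j by omega, add_zero, hy, ha] at hd
  simp only [Option.getD_some, Walk.length_cons, Walk.length_nil] at hd hd2
  exact .inr ⟨by omega, hva⟩

theorem IsInducedPath.good_right (hG : DistHereditary G)
    (htri : ∀ {a b c : V}, G.Adj a b → G.Adj b c → ¬ G.Adj a c) {k : ℕ} {p : ℕ → Option V}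
    (h : IsInducedPath (starGraph G v v') k p) {i j : ℕ} {a : V} (hpos : 0 < i) (hij : i < j)
    (hj : j ≤ k) (hi : p i = none) (ha : p j = some a) :
    a ≠ v ∧ (G.Adj v a → j = i + 1) := by
  by_contra hbad
  have hcase := h.eq_add_two_or_three hG htri hij hj hi ha hbad
  obtain ⟨y, hy⟩ := h.eq_some (i := i) (j := i + 1) (by omega) (by omega) (by omega) hi
  obtain ⟨z, hz⟩ := h.eq_some (i := i) (j := i - 1) (by omega) (by omega) (by omega) hi
  obtain ⟨c, hc⟩ := h.eq_some (i := i) (j := i + 2) (by omega) (by omega) (by omega) hi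
  have adj {m n : ℕ} {s t : V} (hm : m ≤ k) (hn : n ≤ k) (hs : p m = some s)
      (ht : p n = some t) : G.Adj s t ↔ n = m + 1 ∨ m = n + 1 := by
    rw [← h.adj_iff hm hn, hs, ht, starGraph_adj_some_some]
  have adj' {n : ℕ} {t : V} (hn : n ≤ k) (ht : p n = some t) :
      (G.Adj v t ∧ G.Adj v' t) ↔ n = i + 1 ∨ i = n + 1 := by
    rw [← h.adj_iff (by omega) hn, hi, ht, starGraph_adj_none_some]
  have hvy := (adj' (by omega) hy).2 (by omega)
  have hvz := (adj' (by omega) hz).2 (by omega)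
  have hzc : ¬ G.Adj z c := by rw [adj (by omega) (by omega) hz hc]; omega
  have hza : ¬ G.Adj z a := by rw [adj (by omega) hj hz ha]; omega
  obtain ⟨rfl, rfl⟩ | ⟨rfl, hva⟩ := hcase
  · exact hza hvz.1.symm
  have hyc : G.Adj y c := by rw [adj (by omega) (by omega) hy hc]; omega
  have hac : G.Adj a c := by rw [adj hj (by omega) ha hc]; omega
  have hv'a : ¬ G.Adj v' a := by
    have := adj' hj ha
    intro h1
    have := this.1 ⟨hva, h1⟩
    omega
  let q : ℕ → V := fun n => match n with
    | 0 => v' | 1 => z | 2 => v | 3 => a | _ => c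
  have hvv' : ¬ G.Adj v' v := htri hvy.2 hvy.1.symm
  have hv'c : ¬ G.Adj v' c := htri hvy.2 hyc
  have hvc : ¬ G.Adj v c := htri hva hac
  have hq : IsInducedPath G 4 q := by
    have n1 : v' ≠ v := by rintro rfl; exact hv'a hva
    have n2 : v' ≠ a := by rintro rfl; exact hvv' hva.symm
    have n3 : v' ≠ c := by rintro rfl; exact hv'a hac.symm
    have n4 : z ≠ a := by rintro rfl; exact hzc hac
    have n5 : z ≠ c := by rintro rfl; exact hza hac.symm
    have n6 : v ≠ c := by rintro rfl; exact hzc hvz.1.symm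
    intro m n hmn hn
    have := hvz.1.symm
    have := hvz.2.ne
    have := hvz.1.ne'
    have := hva.ne
    have := hac.ne
    interval_cases n <;> interval_cases m <;> simp_all [q]
  have hd := hq.dist_eq hG
  have hd2 := SimpleGraph.dist_le (Walk.cons hvy.2 (Walk.cons hyc Walk.nil))
  simp only [q, Walk.length_cons, Walk.length_nil] at hd hd2
  omega

theorem IsInducedPath.dist_starGraph_of_interior (hG : DistHereditary G)
    (htri : ∀ {a b c : V}, G.Adj a b → G.Adj b c → ¬ G.Adj a c) {k : ℕ} {p : ℕ → Option V}
    (h : IsInducedPath (starGraph G v v') k p) {i : ℕ} (hpos : 0 < i) (hik : i < k)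
    (hi : p i = none) : (starGraph G v v').dist (p 0) (p k) = k := by
  refine h.dist_starGraph_eq hG (h.proj fun i' hi' j hj a hnone ha => ?_)
  obtain rfl := h.injOn hi' hik.le (hnone.trans hi.symm)
  rcases lt_trichotomy i' j with hlt | rfl | hlt
  · exact (h.good_right hG htri hpos hlt hj hi ha).imp_right fun f e => .inl (f e)
  · simp [hi] at ha
  · have := h.reverse.good_right hG htri (i := k - i') (j := k - j) (a := a) (by omega)
      (by omega) (by omega) (by rwa [Nat.sub_sub_self hi']) (by rwa [Nat.sub_sub_self hj])
    refine this.imp_right fun f e => .inr ?_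
    have := f e
    omega

theorem IsInducedPath.proj_or_adj (hG : DistHereditary G)
    (htri : ∀ {a b c : V}, G.Adj a b → G.Adj b c → ¬ G.Adj a c) {k : ℕ} {p : ℕ → Option V}
    (h : IsInducedPath (starGraph G v v') k p) (hk : 3 ≤ k) (h0 : p 0 = none) {b : V}
    (hb : p 3 = some b) :
    IsInducedPath G k (fun n => (p n).getD v) ∨ G.Adj v b := by
  by_contra! hcon
  refine hcon.1 (h.proj fun i hi j hj a hnone ha => ?_)
  obtain rfl := h.injOn hi (Nat.zero_le k) (hnone.trans h0.symm)
  obtain rfl | hpos := Nat.eq_zero_or_pos j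
  · simp [h0] at ha
  by_contra hbad
  obtain ⟨rfl, rfl⟩ | ⟨rfl, hva⟩ := h.eq_add_two_or_three hG htri hpos hj h0 ha
    (fun hg => hbad (hg.imp_right fun f e => .inl (f e)))
  · have := (h 2 3 (by omega) hk).2.2 rfl
    rw [ha, hb, starGraph_adj_some_some] at this
    exact hcon.2 this
  · obtain rfl : a = b := by simpa using ha.symm.trans hb
    exact hcon.2 hva

theorem IsInducedPath.dist_starGraph_of_head (hG : DistHereditary G)
    (htri : ∀ {a b c : V}, G.Adj a b → G.Adj b c → ¬ G.Adj a c) {k : ℕ} {p : ℕ → Option V}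
    (h : IsInducedPath (starGraph G v v') k p) (h0 : p 0 = none) :
    (starGraph G v v').dist (p 0) (p k) = k := by
  by_cases hk : k ≤ 2
  · exact h.dist_eq_of_le_two hk
  obtain ⟨b, hb⟩ := h.eq_some (i := 0) (j := 3) (by omega) (by omega) (by omega) h0
  obtain h1 | h1 := h.proj_or_adj hG htri (by omega) h0 hb
  · exact h.dist_starGraph_eq hG h1
  rw [starGraph_comm] at h ⊢
  obtain h2 | h2 := h.proj_or_adj hG htri (by omega) h0 hb
  · exact h.dist_starGraph_eq hG h2
  have := h.adj_iff (i := 0) (j := 3) (by omega) (by omega)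
  rw [h0, hb, starGraph_adj_none_some] at this
  have := this.1 ⟨h2, h1⟩
  omega

theorem DistHereditary.starGraph (hG : DistHereditary G)
    (htri : ∀ {a b c : V}, G.Adj a b → G.Adj b c → ¬ G.Adj a c) :
    DistHereditary (starGraph G v v') := by
  refine distHereditary_of_isInducedPath_dist fun k p h => ?_
  by_cases hw : ∃ i ≤ k, p i = none
  · obtain ⟨i, hik, hi⟩ := hw
    obtain rfl | hpos := Nat.eq_zero_or_pos i
    · exact h.dist_starGraph_of_head hG htri hi
    obtain rfl | hlt := hik.eq_or_lt
    · have := h.reverse.dist_starGraph_of_head hG htri (by simpa using hi)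
      simpa [SimpleGraph.dist_comm] using this
    · exact h.dist_starGraph_of_interior hG htri hpos hlt hi
  · push Not at hw
    exact h.dist_starGraph_eq hG (h.proj fun i hi _ _ _ hnone => absurd hnone (hw i hi))

theorem IsBipartition.starGraph {X Y : Set V} (h : IsBipartition G X Y) (hv : v ∈ X) :
    IsBipartition (starGraph G v v') (insert (none : Option V) (Option.some '' X))
      (Option.some '' Y) := by
  have hY {b : V} (hb : G.Adj v b) : b ∈ Y := by
    rcases h.2.2 hb with h1 | h1
    · exact h1.2
    · exact absurd h1.1 (Set.disjoint_left.1 h.1 hv)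
  refine ⟨?_, ?_, ?_⟩
  · rw [Set.disjoint_left]
    rintro (_ | a) h1 h2
    · simp at h2
    · exact Set.disjoint_left.1 h.1 (by simpa using h1) (by simpa using h2)
  · ext (_ | a)
    · simp
    · have : a ∈ X ∪ Y := h.2.1 ▸ Set.mem_univ a
      simpa using this
  · rintro (_ | a) (_ | b) hab
    · simp at hab
    · simpa using hY (starGraph_adj_none_some.1 hab).1
    · simpa using hY (starGraph_adj_some_none.1 hab).1
    · simpa using h.2.2 (starGraph_adj_some_some.1 hab)

end StarGraph

/-- BDH graphs are closed under the star operation: adding a new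
vertex adjacent exactly to `N(v) ∩ N(v')` for `v, v'` in the same color class. -/
theorem star_preserves_BDH [Fintype V] (G : SimpleGraph V) (X Y : Set V)
    (hbip : IsBipartition G X Y) (hDH : DistHereditary G)
    (v v' : V) (hv : v ∈ X) (hv' : v' ∈ X) :
    IsBipartition (starGraph G v v') (insert (none : Option V) (Option.some '' X))
        (Option.some '' Y) ∧
      DistHereditary (starGraph G v v') :=
  ⟨hbip.starGraph hv, hDH.starGraph hbip.not_adj_of_adj_of_adj⟩
end

section
/- Let G be a domino-free bipartite graph with color classes X and Y, and let B¹ = (X₁,Y₁) and B² = (X₂,Y₂) be maximal bicliques of G with nonempty shores such that X₁ ⊄ X₂ and X₂ ⊄ X₁ (i.e., B¹ and B² are incomparable). If X₁ ∩ X₂ ≠ ∅, then Y₁ ∩ Y₂ = ∅. -/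
open SimpleGraph

variable {V : Type*}

/-- A vertex of `X` outside the `X`-shore of a maximal biclique misses some vertex of its `Y`-shore. -/
theorem IsMaxBiclique.exists_not_adj {G : SimpleGraph V} {X Y A B : Set V}
    (h : IsMaxBiclique G X Y A B) {a : V} (haX : a ∈ X) (ha : a ∉ A) :
    ∃ b ∈ B, ¬ G.Adj a b := by
  by_contra! hadj
  refine ha ?_
  have hA : A = insert a A :=
    (h.2 (insert a A) B ⟨Set.insert_subset haX h.1.1, h.1.2.1, ?_⟩
      (Set.subset_insert a A) subset_rfl).1
  · rw [hA]
    exact Set.mem_insert a A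
  · rintro u (rfl | hu) b hb
    exacts [hadj b hb, h.1.2.2 u hu b hb]

theorem IsBipartition.not_adj_left {G : SimpleGraph V} {X Y : Set V}
    (h : IsBipartition G X Y) {u v : V} (hu : u ∈ X) (hv : v ∈ X) : ¬ G.Adj u v := fun huv =>
  (h.2.2 huv).elim (fun h' => Set.disjoint_left.1 h.1 hv h'.2)
    (fun h' => Set.disjoint_left.1 h.1 hu h'.1)

theorem IsBipartition.not_adj_right {G : SimpleGraph V} {X Y : Set V}
    (h : IsBipartition G X Y) {u v : V} (hu : u ∈ Y) (hv : v ∈ Y) : ¬ G.Adj u v := fun huv =>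
  (h.2.2 huv).elim (fun h' => Set.disjoint_left.1 h.1 h'.1 hu)
    (fun h' => Set.disjoint_left.1 h.1 h'.2 hv)

/-- In a domino-free bipartite graph, two incomparable maximal
bicliques with nonempty shores whose `X`-shores intersect have disjoint
`Y`-shores. -/
theorem incomparable_maxBicliques_meet_bot_or_join_top [Fintype V]
    (G : SimpleGraph V) (X Y : Set V) (hbip : IsBipartition G X Y)
    (hdf : DominoFree G) (X₁ Y₁ X₂ Y₂ : Set V)
    (hB₁ : (X₁, Y₁) ∈ MaxBicliques G X Y) (hB₂ : (X₂, Y₂) ∈ MaxBicliques G X Y)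
    (h₁₂ : ¬ X₁ ⊆ X₂) (h₂₁ : ¬ X₂ ⊆ X₁) (hmeet : (X₁ ∩ X₂).Nonempty) :
    Y₁ ∩ Y₂ = ∅ := by
  refine Set.eq_empty_iff_forall_notMem.2 fun y hy => hdf ?_
  obtain ⟨x, hx₁, hx₂⟩ := hmeet
  obtain ⟨hy₁, hy₂⟩ := hy
  obtain ⟨a, ha₁, ha₂⟩ := Set.not_subset.1 h₁₂
  obtain ⟨b, hb₂, hb₁⟩ := Set.not_subset.1 h₂₁
  have hM₁ : IsMaxBiclique G X Y X₁ Y₁ := hB₁.1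
  have hM₂ : IsMaxBiclique G X Y X₂ Y₂ := hB₂.1
  obtain ⟨⟨hX₁, hY₁, hadj₁⟩, -⟩ := id hM₁
  obtain ⟨⟨hX₂, hY₂, hadj₂⟩, -⟩ := id hM₂
  obtain ⟨d, hd, had⟩ := hM₂.exists_not_adj (hX₁ ha₁) ha₂
  obtain ⟨c, hc, hbc⟩ := hM₁.exists_not_adj (hX₂ hb₂) hb₁
  have hxc := hadj₁ x hx₁ c hc
  have hxd := hadj₂ x hx₂ d hd
  have hxy := hadj₁ x hx₁ y hy₁
  have hac := hadj₁ a ha₁ c hc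
  have hay := hadj₁ a ha₁ y hy₁
  have hbd := hadj₂ b hb₂ d hd
  have hby := hadj₂ b hb₂ y hy₂
  have hxa := hbip.not_adj_left (hX₁ hx₁) (hX₁ ha₁)
  have hxb := hbip.not_adj_left (hX₁ hx₁) (hX₂ hb₂)
  have hab := hbip.not_adj_left (hX₁ ha₁) (hX₂ hb₂)
  have hyc := hbip.not_adj_right (hY₁ hy₁) (hY₁ hc)
  have hyd := hbip.not_adj_right (hY₁ hy₁) (hY₂ hd)
  have hcd := hbip.not_adj_right (hY₁ hc) (hY₂ hd)
  -- The closed walk `x c a y b d` is a hexagon whose only chord is `x y`.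
  refine ⟨![x, c, a, y, b, d], ?_, ?_⟩
  · intro i j hij
    fin_cases i <;> fin_cases j <;> simp at hij ⊢ <;> grind [SimpleGraph.irrefl]
  · intro i j
    fin_cases i <;> fin_cases j <;> simp [domino, *] <;> grind [SimpleGraph.adj_comm]
end

section
/- Let G be a domino-free bipartite graph with color classes X and Y, let n ≥ 3, and let f : ZMod n → {maximal bicliques of G with both shores nonempty} be an injective map such that for every i, either f(i+1) covers f(i) or f(i) covers f(i+1) in the X-shore-inclusion order (so f describes a cycle in the Hasse diagram). Then the number of indices i such that either (f(i) covers f(i−1) and f(i) covers f(i+1)) or (f(i−1) covers f(i) and f(i+1) covers f(i)) is at least 6. -/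
open SimpleGraph

variable {V : Type*}

namespace IsMaxBiclique

variable {G : SimpleGraph V} {X Y : Set V} {p q : Set V × Set V}

lemma mem_left_s4 (h : IsMaxBiclique G X Y p.1 p.2) {x : V} (hx : x ∈ X)
    (hadj : ∀ b ∈ p.2, G.Adj x b) : x ∈ p.1 := by
  have := (h.2 (insert x p.1) p.2 ⟨Set.insert_subset hx h.1.1, h.1.2.1, ?_⟩
    (Set.subset_insert _ _) subset_rfl).1
  · rw [this]; exact Set.mem_insert _ _
  · rintro a (rfl | ha) b hb
    · exact hadj b hb
    · exact h.1.2.2 a ha b hb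

lemma mem_right (h : IsMaxBiclique G X Y p.1 p.2) {y : V} (hy : y ∈ Y)
    (hadj : ∀ a ∈ p.1, G.Adj a y) : y ∈ p.2 := by
  have := (h.2 p.1 (insert y p.2) ⟨h.1.1, Set.insert_subset hy h.1.2.1, ?_⟩
    subset_rfl (Set.subset_insert _ _)).2
  · rw [this]; exact Set.mem_insert _ _
  · rintro a ha b (rfl | hb)
    · exact hadj a ha
    · exact h.1.2.2 a ha b hb

lemma right_subset (hp : IsMaxBiclique G X Y p.1 p.2) (hq : IsMaxBiclique G X Y q.1 q.2)
    (h : p.1 ⊆ q.1) : q.2 ⊆ p.2 := fun y hy =>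
  hp.mem_right (hq.1.2.1 hy) fun a ha => hq.1.2.2 a (h ha) y hy

lemma eq_of_left_eq (hp : IsMaxBiclique G X Y p.1 p.2) (hq : IsMaxBiclique G X Y q.1 q.2)
    (h : p.1 = q.1) : p = q :=
  Prod.ext h ((hq.right_subset hp h.ge).antisymm (hp.right_subset hq h.le))

end IsMaxBiclique

/-- In a domino-free bipartite graph, maximal bicliques meeting in both shores are comparable. -/
lemma DominoFree.left_subset_or_subset {G : SimpleGraph V} {X Y : Set V}
    (hbip : IsBipartition G X Y) (hdf : DominoFree G) {p q : Set V × Set V}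
    (hp : IsMaxBiclique G X Y p.1 p.2) (hq : IsMaxBiclique G X Y q.1 q.2)
    (hA : (p.1 ∩ q.1).Nonempty) (hB : (p.2 ∩ q.2).Nonempty) :
    p.1 ⊆ q.1 ∨ q.1 ⊆ p.1 := by
  by_contra! hcon
  obtain ⟨xp, hxp, hxpq⟩ := Set.not_subset.1 hcon.1
  obtain ⟨xq, hxq, hxqp⟩ := Set.not_subset.1 hcon.2
  obtain ⟨x, hx, hx'⟩ := hA
  obtain ⟨y, hy, hy'⟩ := hB
  obtain ⟨yq, hyq, nq⟩ : ∃ b ∈ q.2, ¬ G.Adj xp b := by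
    by_contra! h; exact hxpq (hq.mem_left_s4 (hp.1.1 hxp) h)
  obtain ⟨yp, hyp, np⟩ : ∃ b ∈ p.2, ¬ G.Adj xq b := by
    by_contra! h; exact hxqp (hp.mem_left_s4 (hq.1.1 hxq) h)
  have hXX : ∀ u ∈ X, ∀ v ∈ X, ¬ G.Adj u v := fun u hu v hv h => by
    rcases hbip.2.2 h with h | h
    · exact Set.disjoint_left.1 hbip.1 hv h.2
    · exact Set.disjoint_left.1 hbip.1 hu h.1
  have hYY : ∀ u ∈ Y, ∀ v ∈ Y, ¬ G.Adj u v := fun u hu v hv h => by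
    rcases hbip.2.2 h with h | h
    · exact Set.disjoint_left.1 hbip.1 h.1 hu
    · exact Set.disjoint_left.1 hbip.1 h.2 hv
  have hXY : ∀ u ∈ X, ∀ v ∈ Y, u ≠ v := fun u hu v hv h =>
    Set.disjoint_left.1 hbip.1 hu (h ▸ hv)
  have X0 := hp.1.1 hx
  have X1 := hp.1.1 hxp
  have X2 := hq.1.1 hxq
  have Y0 := hp.1.2.1 hy
  have Y1 := hp.1.2.1 hyp
  have Y2 := hq.1.2.1 hyq
  have a0 := hp.1.2.2 x hx y hy
  have a1 := hp.1.2.2 x hx yp hyp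
  have a2 := hq.1.2.2 x hx' yq hyq
  have a3 := hp.1.2.2 xp hxp y hy
  have a4 := hp.1.2.2 xp hxp yp hyp
  have a5 := hq.1.2.2 xq hxq y hy'
  have a6 := hq.1.2.2 xq hxq yq hyq
  have d1 : x ≠ xp := fun h => nq (h ▸ a2)
  have d2 : x ≠ xq := fun h => np (h ▸ a1)
  have d3 : xp ≠ xq := fun h => hxpq (h ▸ hxq)
  have d4 : y ≠ yp := fun h => np (h ▸ a5)
  have d5 : y ≠ yq := fun h => nq (h ▸ a3)
  have d6 : yp ≠ yq := fun h => np (h ▸ a6)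
  refine hdf ⟨![x, yp, xp, y, xq, yq], ?_, ?_⟩
  · have e := fun u hu v hv => (hXY u hu v hv).symm
    intro i j
    fin_cases i <;> fin_cases j <;>
      simp [d1, d2, d3, d4, d5, d6, d1.symm, d2.symm, d3.symm, d4.symm, d5.symm, d6.symm,
        hXY _ X0 _ Y0, hXY _ X0 _ Y1, hXY _ X0 _ Y2, hXY _ X1 _ Y0, hXY _ X1 _ Y1,
        hXY _ X1 _ Y2, hXY _ X2 _ Y0, hXY _ X2 _ Y1, hXY _ X2 _ Y2,
        e _ X0 _ Y0, e _ X0 _ Y1, e _ X0 _ Y2, e _ X1 _ Y0, e _ X1 _ Y1,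
        e _ X1 _ Y2, e _ X2 _ Y0, e _ X2 _ Y1, e _ X2 _ Y2]
  · have np' : ¬ G.Adj yp xq := fun h => np (G.adj_symm h)
    have nq' : ¬ G.Adj yq xp := fun h => nq (G.adj_symm h)
    intro i j
    fin_cases i <;> fin_cases j <;>
      simp [domino, a0, a1, a2, a3, a4, a5, a6, a0.symm, a1.symm, a2.symm, a3.symm, a4.symm,
        a5.symm, a6.symm, np, nq, np', nq', hXX _ X0 _ X1, hXX _ X0 _ X2, hXX _ X1 _ X2,
        hXX _ X1 _ X0, hXX _ X2 _ X0, hXX _ X2 _ X1, hYY _ Y0 _ Y1, hYY _ Y0 _ Y2,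
        hYY _ Y1 _ Y2, hYY _ Y1 _ Y0, hYY _ Y2 _ Y0, hYY _ Y2 _ Y1]

/-- Maximal bicliques whose `X`-shores meet have a common lower bound with `X`-shore the
intersection. -/
lemma exists_mem_maxBicliques_inter {G : SimpleGraph V} {X Y : Set V} {p q : Set V × Set V}
    (hp : p ∈ MaxBicliques G X Y) (hq : q ∈ MaxBicliques G X Y) (h : (p.1 ∩ q.1).Nonempty) :
    ∃ c ∈ MaxBicliques G X Y, c.1 = p.1 ∩ q.1 := by
  have hpB : p.2 ⊆ {y | y ∈ Y ∧ ∀ a ∈ p.1 ∩ q.1, G.Adj a y} := fun y hy =>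
    ⟨hp.1.1.2.1 hy, fun a ha => hp.1.1.2.2 a ha.1 y hy⟩
  have hqB : q.2 ⊆ {y | y ∈ Y ∧ ∀ a ∈ p.1 ∩ q.1, G.Adj a y} := fun y hy =>
    ⟨hq.1.1.2.1 hy, fun a ha => hq.1.1.2.2 a ha.2 y hy⟩
  refine ⟨(p.1 ∩ q.1, {y | y ∈ Y ∧ ∀ a ∈ p.1 ∩ q.1, G.Adj a y}),
    ⟨⟨⟨fun a ha => hp.1.1.1 ha.1, fun y hy => hy.1, fun a ha y hy => hy.2 a ha⟩, ?_⟩,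
      h, hp.2.2.mono hpB⟩, rfl⟩
  intro A' B' hAB hA hB
  refine ⟨hA.antisymm fun a ha => ⟨?_, ?_⟩, hB.antisymm fun y hy => ⟨hAB.2.1 hy, ?_⟩⟩
  · exact hp.1.mem_left_s4 (hAB.1 ha) fun b hb => hAB.2.2 a ha b (hB (hpB hb))
  · exact hq.1.mem_left_s4 (hAB.1 ha) fun b hb => hAB.2.2 a ha b (hB (hqB hb))
  · exact fun a ha => hAB.2.2 a (hA ha) y hy

/-- Intervals in the poset of maximal bicliques of a domino-free bipartite graph are chains. -/
lemma DominoFree.comparable_of_mem_interval {G : SimpleGraph V} {X Y : Set V}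
    (hbip : IsBipartition G X Y) (hdf : DominoFree G) {s t p q : Set V × Set V}
    (hs : s ∈ MaxBicliques G X Y) (ht : t ∈ MaxBicliques G X Y)
    (hp : p ∈ MaxBicliques G X Y) (hq : q ∈ MaxBicliques G X Y)
    (hsp : s.1 ⊆ p.1) (hsq : s.1 ⊆ q.1) (hpt : p.1 ⊆ t.1) (hqt : q.1 ⊆ t.1) :
    p.1 ⊆ q.1 ∨ q.1 ⊆ p.1 :=
  hdf.left_subset_or_subset hbip hp.1 hq.1 (hs.2.1.mono (Set.subset_inter hsp hsq))
    (ht.2.2.mono (Set.subset_inter (hp.1.right_subset ht.1 hpt) (hq.1.right_subset ht.1 hqt)))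

lemma Covers.eq_or_eq {G : SimpleGraph V} {X Y : Set V} {p q c : Set V × Set V}
    (h : Covers G X Y p q) (hc : c ∈ MaxBicliques G X Y) (hpc : p.1 ⊆ c.1) (hcq : c.1 ⊆ q.1) :
    c = p ∨ c = q := by
  by_contra! hne
  refine h.2.2.2 c hc ⟨hpc.ssubset_of_ne fun e => ?_, hcq.ssubset_of_ne fun e => ?_⟩
  · exact hne.1 (hc.1.eq_of_left_eq h.1.1 e.symm)
  · exact hne.2 (hc.1.eq_of_left_eq h.2.1.1 e)

section Chain

variable {G : SimpleGraph V} {X Y : Set V} {g : ℕ → Set V × Set V} {a b : ℕ}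

lemma left_subset_of_ascending (hab : a ≤ b)
    (h : ∀ k, a ≤ k → k < b → Covers G X Y (g k) (g (k + 1))) : (g a).1 ⊆ (g b).1 := by
  induction b, hab using Nat.le_induction with
  | base => exact subset_rfl
  | succ b hab ih =>
    exact (ih fun k h1 h2 => h k h1 (by omega)).trans (h b hab (by omega)).2.2.1.subset

lemma left_subset_of_descending (hab : a ≤ b)
    (h : ∀ k, a ≤ k → k < b → Covers G X Y (g (k + 1)) (g k)) : (g b).1 ⊆ (g a).1 := by
  induction b, hab using Nat.le_induction with
  | base => exact subset_rfl
  | succ b hab ih =>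
    exact (h b hab (by omega)).2.2.1.subset.trans (ih fun k h1 h2 => h k h1 (by omega))

lemma exists_eq_of_ascending (hbip : IsBipartition G X Y) (hdf : DominoFree G)
    (hg : ∀ k, g k ∈ MaxBicliques G X Y) (hab : a ≤ b)
    (h : ∀ k, a ≤ k → k < b → Covers G X Y (g k) (g (k + 1))) {c : Set V × Set V}
    (hc : c ∈ MaxBicliques G X Y) (hac : (g a).1 ⊆ c.1) (hcb : c.1 ⊆ (g b).1) :
    ∃ m, a ≤ m ∧ m ≤ b ∧ g m = c := by
  induction b, hab using Nat.le_induction with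
  | base => exact ⟨a, le_rfl, le_rfl, (hg a).1.eq_of_left_eq hc.1 (hac.antisymm hcb)⟩
  | succ b hab ih =>
    have h' : ∀ k, a ≤ k → k < b → Covers G X Y (g k) (g (k + 1)) :=
      fun k h1 h2 => h k h1 (by omega)
    have hb := h b hab (by omega)
    rcases hdf.comparable_of_mem_interval hbip (hg a) (hg (b + 1)) hc (hg b) hac
      (left_subset_of_ascending hab h') hcb hb.2.2.1.subset with h1 | h1
    · obtain ⟨m, h2, h3, h4⟩ := ih h' h1
      exact ⟨m, h2, by omega, h4⟩
    · rcases hb.eq_or_eq hc h1 hcb with h2 | h2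
      · exact ⟨b, hab, by omega, h2.symm⟩
      · exact ⟨b + 1, by omega, le_rfl, h2.symm⟩

lemma exists_eq_of_descending (hbip : IsBipartition G X Y) (hdf : DominoFree G)
    (hg : ∀ k, g k ∈ MaxBicliques G X Y) (hab : a ≤ b)
    (h : ∀ k, a ≤ k → k < b → Covers G X Y (g (k + 1)) (g k)) {c : Set V × Set V}
    (hc : c ∈ MaxBicliques G X Y) (hbc : (g b).1 ⊆ c.1) (hca : c.1 ⊆ (g a).1) :
    ∃ m, a ≤ m ∧ m ≤ b ∧ g m = c := by
  induction b, hab using Nat.le_induction with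
  | base => exact ⟨a, le_rfl, le_rfl, (hg a).1.eq_of_left_eq hc.1 (hbc.antisymm hca)⟩
  | succ b hab ih =>
    have h' : ∀ k, a ≤ k → k < b → Covers G X Y (g (k + 1)) (g k) :=
      fun k h1 h2 => h k h1 (by omega)
    have hb := h b hab (by omega)
    rcases hdf.comparable_of_mem_interval hbip (hg (b + 1)) (hg a) (hg b) hc hb.2.2.1.subset
      hbc (left_subset_of_descending hab h') hca with h1 | h1
    · obtain ⟨m, h2, h3, h4⟩ := ih h' h1
      exact ⟨m, h2, by omega, h4⟩
    · rcases hb.eq_or_eq hc hbc h1 with h2 | h2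
      · exact ⟨b + 1, by omega, le_rfl, h2.symm⟩
      · exact ⟨b, hab, by omega, h2.symm⟩

end Chain

lemma exists_maximal_run (P : ℕ → Prop) {m n : ℕ} (hmn : m < n) (hm : P m) :
    ∃ m', m < m' ∧ m' ≤ n ∧ (∀ k, m ≤ k → k < m' → P k) ∧ (m' = n ∨ ¬ P m') := by
  classical
  have hex : ∃ m', m < m' ∧ (m' = n ∨ ¬ P m') := ⟨n, hmn, Or.inl rfl⟩
  refine ⟨Nat.find hex, (Nat.find_spec hex).1, Nat.find_min' hex ⟨hmn, Or.inl rfl⟩, ?_,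
    (Nat.find_spec hex).2⟩
  intro k hk hk'
  rcases hk.eq_or_lt with rfl | hk
  · exact hm
  · by_contra hP
    exact Nat.find_min hex hk' ⟨hk, Or.inr hP⟩

/-- Any cycle in the Hasse diagram of the poset of maximal
bicliques of a domino-free bipartite graph has at least six non-flow nodes
(sources and sinks). -/
theorem cycle_in_hasse_has_six_nonflow_nodes [Fintype V]
    (G : SimpleGraph V) (X Y : Set V) (hbip : IsBipartition G X Y)
    (hdf : DominoFree G) (n : ℕ) (hn : 3 ≤ n)
    (f : ZMod n → Set V × Set V)
    (hmem : ∀ i, f i ∈ MaxBicliques G X Y)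
    (hinj : Function.Injective f)
    (hcyc : ∀ i, Covers G X Y (f i) (f (i + 1)) ∨ Covers G X Y (f (i + 1)) (f i)) :
    6 ≤ Set.ncard {i : ZMod n |
      (Covers G X Y (f (i - 1)) (f i) ∧ Covers G X Y (f (i + 1)) (f i)) ∨
      (Covers G X Y (f i) (f (i - 1)) ∧ Covers G X Y (f i) (f (i + 1)))} := by
  have : NeZero n := ⟨by omega⟩
  obtain ⟨t, ht⟩ := Finite.exists_max fun i => (f i).1.ncard
  have hlt : ∀ i, ¬ Covers G X Y (f t) (f i) := fun i h =>
    (Set.ncard_lt_ncard h.2.2.1 (Set.toFinite _)).not_ge (ht i)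
  obtain ⟨g, hgdef⟩ : ∃ g : ℕ → Set V × Set V, ∀ m, g m = f (t + (m : ℕ)) := ⟨_, fun _ => rfl⟩
  have hg : ∀ k, g k ∈ MaxBicliques G X Y := fun k => hgdef k ▸ hmem _
  have hgn : g n = g 0 := by simp [hgdef]
  have hcast : ∀ i j : ℕ, i < j → j < i + n → (t + i : ZMod n) ≠ t + j := by
    intro i j hij hji h
    have h1 := (ZMod.natCast_eq_natCast_iff' i j n).1 (add_left_cancel h)
    have h2 := (Nat.modEq_iff_dvd' hij.le).1 h1
    have := Nat.le_of_dvd (by omega) h2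
    omega
  have hne : ∀ i j : ℕ, i < j → j < i + n → g i ≠ g j := fun i j hij hji h =>
    hcast i j hij hji (hinj (by rwa [hgdef, hgdef] at h))
  have hstep : ∀ m, Covers G X Y (g m) (g (m + 1)) ∨ Covers G X Y (g (m + 1)) (g m) := by
    intro m
    have := hcyc (t + m)
    simpa [hgdef, add_assoc] using this
  have hexcl : ∀ p q, Covers G X Y p q → ¬ Covers G X Y q p := fun p q h h' =>
    h.2.2.1.2 h'.2.2.1.1
  have hD : ∀ m, ¬ Covers G X Y (g m) (g (m + 1)) → Covers G X Y (g (m + 1)) (g m) :=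
    fun m => (hstep m).resolve_left
  have hU : ∀ m, ¬ Covers G X Y (g (m + 1)) (g m) → Covers G X Y (g m) (g (m + 1)) :=
    fun m => (hstep m).resolve_right
  have h0 : Covers G X Y (g (0 + 1)) (g 0) := hD 0 (by simpa [hgdef] using hlt _)
  have hlast : Covers G X Y (g (n - 1)) (g (n - 1 + 1)) := hU _ (by
    rw [Nat.sub_add_cancel (by omega), hgn, hgdef 0]
    simpa [hgdef] using hlt _)
  obtain ⟨e1, h01, h1n, r1, c1⟩ := exists_maximal_run
    (fun m => Covers G X Y (g (m + 1)) (g m)) (show 0 < n by omega) h0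
  have hdesc : ∀ m, m < n → ¬ ∀ k, m ≤ k → k < n → Covers G X Y (g (k + 1)) (g k) :=
    fun m hm h => hexcl _ _ hlast (h (n - 1) (by omega) (by omega))
  replace c1 : ¬ _ := c1.resolve_left fun h => hdesc 0 (by omega) (h ▸ r1)
  have h1n' : e1 < n := h1n.lt_of_ne fun h => hdesc 0 (by omega) (h ▸ r1)
  obtain ⟨e2, h12, h2n, r2, c2⟩ := exists_maximal_run
    (fun m => Covers G X Y (g m) (g (m + 1))) h1n' (hU _ c1)
  have h2n' : e2 < n := by
    refine h2n.lt_of_ne ?_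
    rintro rfl
    obtain ⟨m, hm1, hm2, hm⟩ := exists_eq_of_ascending hbip hdf hg h12.le r2 (hg 1)
      (left_subset_of_descending (by omega) fun k hk hk' => r1 k (by omega) hk')
      (hgn ▸ h0.2.2.1.subset)
    obtain ⟨l, hl1, hl2, hl⟩ := exists_eq_of_descending hbip hdf hg h01.le r1 (hg (e1 + 1))
      (r2 e1 le_rfl h12).2.2.1.subset
      (hgn ▸ left_subset_of_ascending (by omega) fun k hk hk' => r2 k (by omega) hk')
    have hm' : m = 1 := by
      by_contra h
      exact hne 1 m (by omega) (by omega) hm.symm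
    have hl' : ¬ e1 + 1 < l + e2 := fun h => hne l (e1 + 1) (by omega) h hl
    omega
  replace c2 : ¬ _ := c2.resolve_left h2n'.ne
  obtain ⟨e3, h23, h3n, r3, c3⟩ := exists_maximal_run
    (fun m => Covers G X Y (g (m + 1)) (g m)) h2n' (hD _ c2)
  replace c3 : ¬ _ := c3.resolve_left fun h => hdesc _ h2n' (h ▸ r3)
  have h3n' : e3 < n := h3n.lt_of_ne fun h => hdesc _ h2n' (h ▸ r3)
  obtain ⟨e4, h34, h4n, r4, c4⟩ := exists_maximal_run
    (fun m => Covers G X Y (g m) (g (m + 1))) h3n' (hU _ c3)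
  have h4n' : e4 < n := by
    refine h4n.lt_of_ne ?_
    rintro rfl
    have s10 := left_subset_of_descending h01.le r1
    have s12 := left_subset_of_ascending h12.le r2
    have s32 := left_subset_of_descending h23.le r3
    have s30 := left_subset_of_ascending h34.le r4
    rw [hgn] at s30
    obtain ⟨c, hc, hceq⟩ := exists_mem_maxBicliques_inter (hg 0) (hg e2)
      ((hg e1).2.1.mono (Set.subset_inter s10 s12))
    obtain ⟨m, hm1, hm2, hm⟩ := exists_eq_of_descending hbip hdf hg h01.le r1 hc
      (hceq ▸ Set.subset_inter s10 s12) (hceq ▸ Set.inter_subset_left)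
    obtain ⟨l, hl1, hl2, hl⟩ := exists_eq_of_descending hbip hdf hg h23.le r3 hc
      (hceq ▸ Set.subset_inter s30 s32) (hceq ▸ Set.inter_subset_right)
    exact hne m l (by omega) (by omega) (hm.trans hl.symm)
  replace c4 : ¬ _ := c4.resolve_left h4n'.ne
  obtain ⟨e5, h45, h5n, r5, c5⟩ := exists_maximal_run
    (fun m => Covers G X Y (g (m + 1)) (g m)) h4n' (hD _ c4)
  replace c5 : ¬ _ := c5.resolve_left fun h => hdesc _ h4n' (h ▸ r5)
  have h5n' : e5 < n := h5n.lt_of_ne fun h => hdesc _ h4n' (h ▸ r5)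
  have hpred : ∀ e : ℕ, 0 < e → g (e - 1) = f (t + e - 1) := fun e he => by
    rw [hgdef, Nat.cast_sub he]; congr 1; push_cast; ring
  have hsucc : ∀ e : ℕ, g (e + 1) = f (t + e + 1) := fun e => by
    rw [hgdef]; congr 1; push_cast; ring
  have peak : ∀ a e, a < e → (∀ k, a ≤ k → k < e → Covers G X Y (g k) (g (k + 1))) →
      ¬ Covers G X Y (g e) (g (e + 1)) →
      (Covers G X Y (f (t + e - 1)) (f (t + e)) ∧ Covers G X Y (f (t + e + 1)) (f (t + e))) := by
    intro a e hae h h'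
    have h1 := h (e - 1) (by omega) (by omega)
    rw [Nat.sub_add_cancel (by omega)] at h1
    rw [← hpred e (by omega), ← hsucc, ← hgdef]
    exact ⟨h1, hD _ h'⟩
  have valley : ∀ a e, a < e → (∀ k, a ≤ k → k < e → Covers G X Y (g (k + 1)) (g k)) →
      ¬ Covers G X Y (g (e + 1)) (g e) →
      (Covers G X Y (f (t + e)) (f (t + e - 1)) ∧ Covers G X Y (f (t + e)) (f (t + e + 1))) := by
    intro a e hae h h'
    have h1 := h (e - 1) (by omega) (by omega)
    rw [Nat.sub_add_cancel (by omega)] at h1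
    rw [← hpred e (by omega), ← hsucc, ← hgdef]
    exact ⟨h1, hU _ h'⟩
  have top : Covers G X Y (f (t + (0 : ℕ) - 1)) (f (t + (0 : ℕ))) ∧
      Covers G X Y (f (t + (0 : ℕ) + 1)) (f (t + (0 : ℕ))) := by
    refine ⟨?_, by rwa [← hsucc, ← hgdef]⟩
    rw [Nat.sub_add_cancel (by omega), hgn, hpred n (by omega), hgdef 0] at hlast
    simpa using hlast
  let E : Finset ℕ := {0, e1, e2, e3, e4, e5}
  have hE : E.card = 6 := by
    have : E = {0, e1, e2, e3, e4, e5} := rfl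
    rw [this]
    repeat rw [Finset.card_insert_of_notMem (by simp; omega)]
    simp
  have hEn : ∀ e ∈ E, e < n := by
    intro e he
    simp only [E, Finset.mem_insert, Finset.mem_singleton] at he
    omega
  rw [← hE, ← Set.ncard_coe_finset]
  refine Set.ncard_le_ncard_of_injOn (fun e : ℕ => (t + e : ZMod n)) ?_ ?_ (Set.toFinite _)
  · intro e he
    simp only [E, Finset.coe_insert, Finset.coe_singleton, Set.mem_insert_iff,
      Set.mem_singleton_iff] at he
    rcases he with rfl | rfl | rfl | rfl | rfl | rfl
    · exact Or.inl top
    · exact Or.inr (valley _ _ h01 r1 c1)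
    · exact Or.inl (peak _ _ h12 r2 c2)
    · exact Or.inr (valley _ _ h23 r3 c3)
    · exact Or.inl (peak _ _ h34 r4 c4)
    · exact Or.inr (valley _ _ h45 r5 c5)
  · intro i hi j hj hij
    have hin := hEn i hi
    have hjn := hEn j hj
    rcases lt_trichotomy i j with h | h | h
    · exact (hcast i j h (by omega) hij).elim
    · exact h
    · exact (hcast j i h (by omega) hij.symm).elim
end

section
/- Let G be a bipartite graph with color classes X and Y and let v ∈ X; write G − v for the graph obtained from G by deleting v, and for a biclique B = (A,C) of G write B − v for the pair (A \ {v}, C). Let B and B₀ be maximal bicliques of G such that B − v and B₀ − v are maximal bicliques of G − v. Then the X-shore of B₀ is contained in the X-shore of B if and only if the X-shore of B₀ − v is contained in the X-shore of B − v; symmetrically with the roles of B and B₀ exchanged; hence the map B − v ↦ B is an order embedding with respect to the X-shore-inclusion orders on maximal bicliques of G − v and of G. -/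
open SimpleGraph

variable {V : Type*}

/-- A biclique whose `X`-shore contains that of a maximal biclique has the smaller `Y`-shore. -/
theorem IsMaxBiclique.right_subset_of_left_subset {G : SimpleGraph V} {X Y A C A₀ C₀ : Set V}
    (h₀ : IsMaxBiclique G X Y A₀ C₀) (h : IsBiclique G X Y A C) (hA : A₀ ⊆ A) : C ⊆ C₀ := by
  obtain ⟨⟨hX, hY, hadj⟩, hmax⟩ := h₀
  have key := (hmax A₀ (C₀ ∪ C) ⟨hX, Set.union_subset hY h.2.1, fun a ha c hc => hc.elim
    (hadj a ha c) (h.2.2 a (hA ha) c)⟩ subset_rfl Set.subset_union_left).2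
  exact key ▸ Set.subset_union_right

/-- A biclique whose `Y`-shore contains that of a maximal biclique has the smaller `X`-shore. -/
theorem IsMaxBiclique.left_subset_of_right_subset {G : SimpleGraph V} {X Y A C A₀ C₀ : Set V}
    (h : IsMaxBiclique G X Y A C) (h₀ : IsBiclique G X Y A₀ C₀) (hC : C ⊆ C₀) : A₀ ⊆ A := by
  obtain ⟨⟨hX, hY, hadj⟩, hmax⟩ := h
  have key := (hmax (A ∪ A₀) C ⟨Set.union_subset hX h₀.1, hY, fun a ha c hc => ha.elim
    (fun ha => hadj a ha c hc) (fun ha => h₀.2.2 a ha c (hC hc))⟩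
    Set.subset_union_left subset_rfl).1
  exact key ▸ Set.subset_union_right

/-- If `B - v` and `B₀ - v` are maximal bicliques of `G - v`,
then the `X`-shore orders of `B, B₀` in `G` and of `B - v, B₀ - v` in `G - v`
agree; hence `B - v ↦ B` is an order embedding. -/
theorem deleteVert_order_embedding [Fintype V] (G : SimpleGraph V)
    (X Y : Set V) (hbip : IsBipartition G X Y) (v : V) (hv : v ∈ X)
    (B B₀ : Set V × Set V)
    (hB : IsMaxBiclique G X Y B.1 B.2)
    (hB₀ : IsMaxBiclique G X Y B₀.1 B₀.2)
    (hBv : IsMaxBiclique (deleteVert G v) (X \ {v}) Y (B.1 \ {v}) B.2)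
    (hB₀v : IsMaxBiclique (deleteVert G v) (X \ {v}) Y (B₀.1 \ {v}) B₀.2) :
    (B₀.1 ⊆ B.1 ↔ B₀.1 \ {v} ⊆ B.1 \ {v}) ∧
      (B.1 ⊆ B₀.1 ↔ B.1 \ {v} ⊆ B₀.1 \ {v}) :=
    ⟨⟨fun h => Set.sdiff_subset_sdiff_left h, fun h =>
      hB.left_subset_of_right_subset hB₀.1 (hB₀v.right_subset_of_left_subset hBv.1 h)⟩,
    ⟨fun h => Set.sdiff_subset_sdiff_left h, fun h =>
      hB₀.left_subset_of_right_subset hB.1 (hBv.right_subset_of_left_subset hB₀v.1 h)⟩⟩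
end

section
/- Let (T, ≤) be a finite partial order such that for every t ∈ T the set {s ∈ T : s ≤ t} is a chain (a forest order, as induced by an arborescence), and let I be the collection of all intervals [a,b] = {t ∈ T : a ≤ t ≤ b} over pairs a ≤ b in T. Then the poset (I, ⊆) admits an order embedding into a product of three linearly ordered sets; that is, the containment order among directed paths in an arborescence has order dimension at most 3. -/
open SimpleGraph

variable {V : Type*}

/-- A finite set in a forest order is realized by two `ℕ`-valued functions: a finite forest order
has dimension at most two. -/
theorem exists_two_realizer_of_forest {T : Type*} [PartialOrder T]
    (hforest : ∀ t : T, IsChain (· ≤ ·) {s : T | s ≤ t}) (S : Finset T) :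
    ∃ p q : T → ℕ, ∀ x ∈ S, ∀ y ∈ S, x ≤ y ↔ p x ≤ p y ∧ q x ≤ q y := by
  classical
  induction S using Finset.strongInduction with
  | H S ih =>
    rcases S.eq_empty_or_nonempty with rfl | hS
    · exact ⟨fun _ => 0, fun _ => 0, by simp⟩
    obtain ⟨r, hr⟩ := S.exists_minimal hS
    obtain ⟨pA, qA, hA⟩ := ih (S.filter (r < ·))
      (Finset.filter_ssubset.2 ⟨r, hr.prop, lt_irrefl r⟩)
    obtain ⟨pB, qB, hB⟩ := ih (S.filter (¬ r ≤ ·))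
      (Finset.filter_ssubset.2 ⟨r, hr.prop, not_not.2 le_rfl⟩)
    simp only [Finset.mem_filter, and_imp] at hA hB
    have above_of_le : ∀ x ∈ S, ∀ y ∈ S, r ≤ x → y ≤ x → r ≤ y := fun x _ y hy hrx hyx =>
      ((hforest x).total hrx hyx).elim id fun h => hr.le_of_le hy h
    obtain ⟨M, hpA⟩ : ∃ M, ∀ x ∈ S, pA x ≤ M := ⟨S.sup pA, fun _ hx => Finset.le_sup hx⟩
    obtain ⟨N, hqB⟩ : ∃ N, ∀ x ∈ S, qB x ≤ N := ⟨S.sup qB, fun _ hx => Finset.le_sup hx⟩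
    refine ⟨fun x => if x = r then 0 else if r ≤ x then pA x + 1 else pB x + M + 2,
      fun x => if x = r then N + 1 else if r ≤ x then qA x + N + 2 else qB x,
      fun x hx y hy => ?_⟩
    have hx₁ := hpA x hx
    have hy₁ := hpA y hy
    have hx₂ := hqB x hx
    have hy₂ := hqB y hy
    have hxy := above_of_le x hx y hy
    have hyx := above_of_le y hy x hx
    have hAxy := hA x hx
    have hBxy := hB x hx
    rcases eq_or_ne x r with rfl | hxr
    · rcases eq_or_ne y x with rfl | hyr
      · simp
      · by_cases h : x ≤ y <;> simp [hyr, h] <;> omega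
    · rcases eq_or_ne y r with rfl | hyr
      · by_cases h : y ≤ x
        · have : ¬ x ≤ y := fun h' => hxr (le_antisymm h' h)
          simp [hxr, h, this]
        · have : ¬ x ≤ y := fun h' => h (hyx le_rfl h')
          simp [hxr, h, this]
      · by_cases h : r ≤ x <;> by_cases h' : r ≤ y
        · simp [hxr, hyr, h, h', hAxy (lt_of_le_of_ne h hxr.symm) y hy
            (lt_of_le_of_ne h' hyr.symm)]
        · have : ¬ x ≤ y := fun h'' => h' (h.trans h'')
          simp [hxr, hyr, h, h', this]
          omega
        · have : ¬ x ≤ y := fun h'' => h (hyx h' h'')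
          simp [hxr, hyr, h, h', this]
          omega
        · simp [hxr, hyr, h, h', hBxy h y hy h']

/-- In a forest order, elements with a common upper bound are compared by any strictly monotone
function. -/
theorem le_iff_of_forest_of_strictMono {T : Type*} [PartialOrder T]
    (hforest : ∀ t : T, IsChain (· ≤ ·) {s : T | s ≤ t}) {α : Type*} [Preorder α] {h : T → α}
    (hh : StrictMono h) {a c d : T} (ha : a ≤ d) (hc : c ≤ d) : c ≤ a ↔ h c ≤ h a := by
  refine ⟨fun hca => hh.monotone hca, fun hle => ?_⟩
  rcases (hforest d).total hc ha with hca | hac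
  · exact hca
  · rcases hac.eq_or_lt with rfl | hlt
    · exact le_rfl
    · exact absurd hle (hh hlt).not_ge

/-- The containment order among the intervals of a finite forest
order (directed paths of an arborescence) has order dimension at most 3. -/
theorem interval_containment_dim_le_three (T : Type*) [Fintype T] [PartialOrder T]
    (hforest : ∀ t : T, IsChain (· ≤ ·) {s : T | s ≤ t}) :
    ∃ (L₁ L₂ L₃ : Type) (_ : LinearOrder L₁) (_ : LinearOrder L₂)
      (_ : LinearOrder L₃)
      (f : {I : Set T // ∃ a b : T, a ≤ b ∧ I = Set.Icc a b} → L₁ × L₂ × L₃),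
      ∀ s t : {I : Set T // ∃ a b : T, a ≤ b ∧ I = Set.Icc a b},
        s.val ⊆ t.val ↔ f s ≤ f t := by
  classical
  obtain ⟨p, q, hpq⟩ := exists_two_realizer_of_forest hforest Finset.univ
  let depth : T → ℕ := fun a => (Finset.univ.filter (· ≤ a)).card
  have depth_strictMono : StrictMono depth := fun a b hab =>
    Finset.card_lt_card <| Finset.ssubset_iff_of_subset
      (Finset.monotone_filter_right _ fun x _ hx => hx.trans hab.le) |>.2
      ⟨b, by simp, by simpa using hab.not_ge⟩
  choose a b hab hI using
    fun I : {I : Set T // ∃ a b : T, a ≤ b ∧ I = Set.Icc a b} => I.2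
  refine ⟨ℕ, ℕ, ℕᵒᵈ, inferInstance, inferInstance, inferInstance,
    fun I => (p (b I), q (b I), OrderDual.toDual (depth (a I))), fun s t => ?_⟩
  rw [hI s, hI t, Set.Icc_subset_Icc_iff (hab s)]
  simp only [Prod.mk_le_mk, OrderDual.toDual_le_toDual]
  rw [← and_assoc, ← hpq _ (Finset.mem_univ _) _ (Finset.mem_univ _), and_comm]
  exact and_congr_right fun hbd =>
    le_iff_of_forest_of_strictMono hforest depth_strictMono ((hab s).trans hbd) (hab t)
end
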